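/- arXiv:0809.3845 — 2 statements merged into one kernel-verified Lean document; each statement's English description precedes it below -/
import Mathlib

section
/- Let N ≥ 2. Then the infimum α_N := inf_{a∈ℝ} α(a) is attained and satisfies α_N < 2N, and for every α₀ ∈ (α_N, 2N) there exist at least two distinct values a₁ ≠ a₂ in ℝ with α(a₁) = α(a₂) = α₀; in other words, for such α₀ there exist at least two distinct radial solutions at level α₀. -/
open Real Set MeasureTheory Filter

noncomputable section

/-- `u` is a radial solution of the Liouville equation
`u'' + u'/r + (1+r²)^N e^{2u} = 0` on `(0,∞)`, of class `C²` on `[0,∞)`,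
with `u'(0) = 0` and finite mass `∫₀^∞ (1+r²)^N e^{2u} r dr < ∞`. -/
def IsSol (N : ℝ) (u : ℝ → ℝ) : Prop :=
  ContDiffOn ℝ 2 u (Ici 0) ∧
  (∀ r : ℝ, 0 < r →
    deriv (deriv u) r + deriv u r / r + (1 + r ^ 2) ^ N * Real.exp (2 * u r) = 0) ∧
  derivWithin u (Ici 0) 0 = 0 ∧
  IntegrableOn (fun r => (1 + r ^ 2) ^ N * Real.exp (2 * u r) * r) (Ioi 0)

/-- `u` is a radial solution at level `α₀`: a `C²([0,∞))` solution of
`u'' + u'/r + (1+r²)^N e^{2u} = 0` on `(0,∞)` with `u'(0) = 0` and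
`∫₀^∞ (1+r²)^N e^{2u} r dr = α₀`. -/
def IsSolAtLevel (N α₀ : ℝ) (u : ℝ → ℝ) : Prop :=
  ContDiffOn ℝ 2 u (Ici 0) ∧
  (∀ r : ℝ, 0 < r →
    deriv (deriv u) r + deriv u r / r + (1 + r ^ 2) ^ N * Real.exp (2 * u r) = 0) ∧
  derivWithin u (Ici 0) 0 = 0 ∧
  IntegrableOn (fun r => (1 + r ^ 2) ^ N * Real.exp (2 * u r) * r) (Ioi 0) ∧
  (∫ r in Ioi (0:ℝ), (1 + r ^ 2) ^ N * Real.exp (2 * u r) * r) = α₀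

theorem le_of_hasDerivAt_nonneg {g g' : ℝ → ℝ} {a b : ℝ} (hab : a ≤ b)
    (hc : ContinuousOn g (Icc a b)) (hd : ∀ x ∈ Ioo a b, HasDerivAt g (g' x) x)
    (h0 : ∀ x ∈ Ioo a b, 0 ≤ g' x) : g a ≤ g b := by
  refine monotoneOn_of_deriv_nonneg (convex_Icc a b) hc ?_ ?_ (left_mem_Icc.2 hab)
    (right_mem_Icc.2 hab) hab
  · rw [interior_Icc]
    exact fun x hx => (hd x hx).differentiableAt.differentiableWithinAt
  · rw [interior_Icc]
    intro x hx
    rw [(hd x hx).deriv]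
    exact h0 x hx

theorem lt_of_hasDerivAt_pos {g g' : ℝ → ℝ} {a b : ℝ} (hab : a < b)
    (hc : ContinuousOn g (Icc a b)) (hd : ∀ x ∈ Ioo a b, HasDerivAt g (g' x) x)
    (h0 : ∀ x ∈ Ioo a b, 0 < g' x) : g a < g b := by
  refine strictMonoOn_of_deriv_pos (convex_Icc a b) hc ?_ (left_mem_Icc.2 hab.le)
    (right_mem_Icc.2 hab.le) hab
  rw [interior_Icc]
  intro x hx
  rw [(hd x hx).deriv]
  exact h0 x hx

/-- A continuous function that is negative at `c` and nonnegative at `b` has a first zero. -/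
theorem exists_first_zero {g : ℝ → ℝ} {c b : ℝ} (hcb : c ≤ b) (hg : ContinuousOn g (Icc c b))
    (hc : g c < 0) (hb : 0 ≤ g b) :
    ∃ z ∈ Ioc c b, g z = 0 ∧ ∀ x ∈ Ico c z, g x < 0 := by
  have hS : IsCompact (Icc c b ∩ g ⁻¹' Ici 0) :=
    isCompact_Icc.of_isClosed_subset (hg.preimage_isClosed_of_isClosed isClosed_Icc isClosed_Ici)
      inter_subset_left
  obtain ⟨z, ⟨hz, hz0⟩, hmin⟩ := hS.exists_isLeast ⟨b, ⟨hcb, le_rfl⟩, hb⟩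
  have hneg : ∀ x ∈ Ico c z, g x < 0 := by
    intro x hx
    by_contra h
    exact absurd (hmin ⟨⟨hx.1, hx.2.le.trans hz.2⟩, not_lt.1 h⟩) (not_le.2 hx.2)
  have hcz : c < z := by
    rcases hz.1.eq_or_lt with h | h
    · subst h; exact absurd hz0 (not_le.2 hc)
    · exact h
  refine ⟨z, ⟨hcz, hz.2⟩, le_antisymm ?_ hz0, hneg⟩
  have hcont : ContinuousWithinAt g (Ico c z) z :=
    (hg z hz).mono fun x hx => ⟨hx.1, hx.2.le.trans hz.2⟩
  have : (nhdsWithin z (Ico c z)).NeBot := by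
    rw [← mem_closure_iff_nhdsWithin_neBot, closure_Ico hcz.ne]
    exact right_mem_Icc.2 hcz.le
  exact le_of_tendsto hcont (eventually_nhdsWithin_of_forall fun x hx => (hneg x hx).le)

/-- The radial Liouville equation in the variable `x = r² / (1 + r²)`: `M` is the mass
accumulated up to `x`, with density `P`, initial density `p` and total mass `A`. -/
structure IsProfile (N p A : ℝ) (M P : ℝ → ℝ) : Prop where
  derivM : ∀ x ∈ Ioo (0:ℝ) 1, HasDerivAt M (P x) x
  derivP : ∀ x ∈ Ioo (0:ℝ) 1, HasDerivAt P (P x * ((N + 2) * x - M x) / (x * (1 - x))) x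
  pos : ∀ x ∈ Ico (0:ℝ) 1, 0 < P x
  contM : ContinuousOn M (Ico 0 1)
  contP : ContinuousOn P (Ico 0 1)
  M_zero : M 0 = 0
  P_zero : P 0 = p
  lim : Tendsto M (nhdsWithin 1 (Iio 1)) (nhds A)

theorem isProfile_linear {N : ℝ} (hN : 0 < N + 2) :
    IsProfile N (N + 2) (N + 2) (fun x => (N + 2) * x) (fun _ => N + 2) where
  derivM x _ := by simpa using (hasDerivAt_id x).const_mul (N + 2)
  derivP x _ := by simpa using hasDerivAt_const x (N + 2)
  pos _ _ := hN
  contM := by fun_prop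
  contP := by fun_prop
  M_zero := by simp
  P_zero := rfl
  lim := by
    have : Continuous fun x : ℝ => (N + 2) * x := by fun_prop
    simpa using (this.tendsto 1).mono_left nhdsWithin_le_nhds

namespace IsProfile

variable {N p A : ℝ} {M P : ℝ → ℝ}

theorem lt (h : IsProfile N p A M P) {x y : ℝ} (hx : 0 ≤ x) (hxy : x < y) (hy : y < 1) :
    M x < M y := by
  refine lt_of_hasDerivAt_pos hxy (h.contM.mono fun z hz => ⟨hx.trans hz.1, hz.2.trans_lt hy⟩)
    (fun z hz => h.derivM z ⟨hx.trans_lt hz.1, hz.2.trans hy⟩)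
    fun z hz => h.pos z ⟨hx.trans hz.1.le, hz.2.trans hy⟩

theorem nonneg (h : IsProfile N p A M P) {x : ℝ} (hx : x ∈ Ico (0:ℝ) 1) : 0 ≤ M x := by
  rcases hx.1.eq_or_lt with h0 | h0
  · rw [← h0, h.M_zero]
  · simpa [h.M_zero] using (h.lt le_rfl h0 hx.2).le

theorem lt_total (h : IsProfile N p A M P) {x : ℝ} (hx : x ∈ Ico (0:ℝ) 1) : M x < A := by
  have hm : x < (x + 1) / 2 ∧ (x + 1) / 2 < 1 := by constructor <;> linarith [hx.2]
  refine (h.lt hx.1 hm.1 hm.2).trans_le (ge_of_tendsto h.lim ?_)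
  filter_upwards [Ioo_mem_nhdsLT hm.2] with y hy
  exact (h.lt (by linarith [hx.1]) hy.1 hy.2).le

theorem total_pos (h : IsProfile N p A M P) : 0 < A := by
  simpa [h.M_zero] using h.lt_total (x := 0) (by norm_num)

theorem p_pos (h : IsProfile N p A M P) : 0 < p := by
  simpa [h.P_zero] using h.pos 0 (by norm_num)

/-- The function `r² (1 + r²)^N e^{2u}` in the variable `x`. -/
theorem hasDerivAt_flux (h : IsProfile N p A M P) {x : ℝ} (hx : x ∈ Ioo (0:ℝ) 1) :
    HasDerivAt (fun y => 2 * y * (1 - y) * P y) (2 * P x * (1 + N * x - M x)) x := by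
  have h1 := (((hasDerivAt_id x).const_mul 2).mul ((hasDerivAt_id x).const_sub 1)).mul
    (h.derivP x hx)
  refine h1.congr_deriv ?_
  have : x ≠ 0 := hx.1.ne'
  have : 1 - x ≠ 0 := by linarith [hx.2]
  simp
  field_simp
  ring

theorem continuousOn_flux (h : IsProfile N p A M P) :
    ContinuousOn (fun y => 2 * y * (1 - y) * P y) (Ico 0 1) :=
  ContinuousOn.mul (by fun_prop) h.contP

theorem flux_pos (h : IsProfile N p A M P) {x : ℝ} (hx : x ∈ Ioo (0:ℝ) 1) :
    0 < 2 * x * (1 - x) * P x := by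
  have := h.pos x ⟨hx.1.le, hx.2⟩
  have := hx.1
  have : 0 < 1 - x := by linarith [hx.2]
  positivity

theorem flux_le (hN : 0 ≤ N) (h : IsProfile N p A M P) {x : ℝ} (hx : x ∈ Ioo (0:ℝ) 1) :
    2 * x * (1 - x) * P x ≤ 2 * A * (A - M x) := by
  by_contra! hlt
  set d := 2 * x * (1 - x) * P x - 2 * A * (A - M x) with hd
  have hdpos : 0 < d := by linarith
  have hfd : ∀ y ∈ Ico x 1, d ≤ 2 * y * (1 - y) * P y := by
    intro y hy
    have hsub : Icc x y ⊆ Ico 0 1 := fun z hz => ⟨hx.1.le.trans hz.1, hz.2.trans_lt hy.2⟩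
    have := le_of_hasDerivAt_nonneg (g := fun z => 2 * z * (1 - z) * P z + 2 * A * M z)
      (g' := fun z => 2 * P z * (1 + N * z - M z) + 2 * A * P z) hy.1
      ((h.continuousOn_flux.mono hsub).add ((h.contM.mono hsub).const_mul _ |>.congr
        fun z _ => rfl))
      (fun z hz => (h.hasDerivAt_flux ⟨hx.1.trans hz.1, hz.2.trans hy.2⟩).add
        ((h.derivM z ⟨hx.1.trans hz.1, hz.2.trans hy.2⟩).const_mul _))
      (fun z hz => by
        have hz' : z ∈ Ico (0:ℝ) 1 := ⟨hx.1.le.trans hz.1.le, hz.2.trans hy.2⟩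
        have h1 := h.lt_total hz'
        have h2 := h.pos z hz'
        have h3 : 0 ≤ N * z := mul_nonneg hN hz'.1
        have : 0 ≤ 2 * P z * (1 + N * z + (A - M z)) := by
          apply mul_nonneg <;> linarith
        linarith)
    have h1 := h.lt_total (x := y) ⟨hx.1.le.trans hy.1, hy.2⟩
    have h2 : 2 * A * M y ≤ 2 * A * A := by
      apply mul_le_mul_of_nonneg_left h1.le; linarith [h.total_pos]
    linarith
  have key : ∀ y ∈ Ico x 1, M x + d / 2 * log (1 - x) ≤ A + d / 2 * log (1 - y) := by
    intro y hy
    have hsub : Icc x y ⊆ Ico 0 1 := fun z hz => ⟨hx.1.le.trans hz.1, hz.2.trans_lt hy.2⟩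
    have hne : ∀ z ∈ Icc x y, 1 - z ≠ 0 := fun z hz => by linarith [(hsub hz).2]
    have := le_of_hasDerivAt_nonneg (g := fun z => M z + d / 2 * log (1 - z))
      (g' := fun z => P z + d / 2 * (-1 / (1 - z))) hy.1
      ((h.contM.mono hsub).add (continuousOn_const.mul
        (ContinuousOn.log (by fun_prop) hne)))
      (fun z hz => (h.derivM z ⟨hx.1.trans hz.1, hz.2.trans hy.2⟩).add
        ((((hasDerivAt_id z).const_sub 1).log (hne z ⟨hz.1.le, hz.2.le⟩)).const_mul _))
      (fun z hz => by
        have h1 := hfd z ⟨hz.1.le, hz.2.trans hy.2⟩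
        have hz0 : 0 < z := hx.1.trans hz.1
        have hz1 : 0 < 1 - z := by linarith [hz.2, hy.2]
        have h2 := h.pos z ⟨hz0.le, by linarith⟩
        have h3 : d ≤ 2 * (1 - z) * P z := by
          have : 0 ≤ (1 - z) * ((1 - z) * P z) := by positivity
          nlinarith
        have : P z + d / 2 * (-1 / (1 - z)) = (2 * (1 - z) * P z - d) / (2 * (1 - z)) := by
          field_simp
          ring
        rw [this]
        exact div_nonneg (by linarith) (by linarith))
    linarith [h.lt_total (x := y) ⟨hx.1.le.trans hy.1, hy.2⟩]
  have hT : Tendsto (fun y : ℝ => A + d / 2 * log (1 - y)) (nhdsWithin 1 (Iio 1)) atBot := by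
    refine tendsto_atBot_add_const_left _ _ (Tendsto.const_mul_atBot (by linarith) ?_)
    refine tendsto_log_nhdsGT_zero.comp ?_
    refine tendsto_nhdsWithin_iff.2 ⟨?_, ?_⟩
    · have : Continuous fun y : ℝ => 1 - y := by fun_prop
      simpa using (this.tendsto 1).mono_left nhdsWithin_le_nhds
    · filter_upwards [self_mem_nhdsWithin] with y hy
      simpa using hy
  obtain ⟨y, hy1, hy2⟩ := ((hT.eventually_lt_atBot (M x + d / 2 * log (1 - x))).and
    (Ico_mem_nhdsLT hx.2)).exists
  linarith [key y hy2]

theorem tendsto_flux (hN : 0 ≤ N) (h : IsProfile N p A M P) :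
    Tendsto (fun y => 2 * y * (1 - y) * P y) (nhdsWithin 1 (Iio 1)) (nhds 0) := by
  have h1 : Tendsto (fun y => 2 * A * (A - M y)) (nhdsWithin 1 (Iio 1)) (nhds 0) := by
    simpa using (h.lim.const_sub A).const_mul (2 * A)
  refine tendsto_of_tendsto_of_tendsto_of_le_of_le' tendsto_const_nhds h1 ?_ ?_
  · filter_upwards [Ioo_mem_nhdsLT zero_lt_one] with y hy using (h.flux_pos hy).le
  · filter_upwards [Ioo_mem_nhdsLT zero_lt_one] with y hy using h.flux_le hN hy

/-- Upper Pohozaev bound on the flux over the tail `(x, 1)`. -/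
theorem flux_le_tail (hN : 0 ≤ N) (h : IsProfile N p A M P) {x : ℝ} (hx : x ∈ Ioo (0:ℝ) 1) :
    2 * x * (1 - x) * P x ≤ (A - M x) * (A + M x - 2 - 2 * N * x) := by
  have hT : Tendsto (fun y => 2 * y * (1 - y) * P y - (A - M y) * (A + M y - 2 - 2 * N * x))
      (nhdsWithin 1 (Iio 1)) (nhds 0) := by
    have := (h.tendsto_flux hN).sub
      ((h.lim.const_sub A).mul (((h.lim.const_add A).sub_const 2).sub_const (2 * N * x)))
    simpa using this
  have : 2 * x * (1 - x) * P x - (A - M x) * (A + M x - 2 - 2 * N * x) ≤ 0 := by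
    refine ge_of_tendsto hT ?_
    filter_upwards [Ico_mem_nhdsLT hx.2] with y hy
    have hsub : Icc x y ⊆ Ico 0 1 := fun z hz => ⟨hx.1.le.trans hz.1, hz.2.trans_lt hy.2⟩
    have hM := h.contM.mono hsub
    refine le_of_hasDerivAt_nonneg
      (g := fun z => 2 * z * (1 - z) * P z - (A - M z) * (A + M z - 2 - 2 * N * x))
      (g' := fun z => 2 * N * P z * (z - x)) hy.1
      ((h.continuousOn_flux.mono hsub).sub (by fun_prop)) (fun z hz => ?_) (fun z hz => ?_)
    · have hz' : z ∈ Ioo (0:ℝ) 1 := ⟨hx.1.trans hz.1, hz.2.trans hy.2⟩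
      have hd := h.derivM z hz'
      refine ((h.hasDerivAt_flux hz').sub ((hd.const_sub A).mul
        (((hd.const_add A).sub_const 2).sub_const (2 * N * x)))).congr_deriv ?_
      ring
    · have := h.pos z ⟨hx.1.le.trans hz.1.le, hz.2.trans hy.2⟩
      have : 0 ≤ z - x := by linarith [hz.1]
      positivity
  linarith

/-- Lower Pohozaev bound on the flux over the tail `(x, 1)`. -/
theorem tail_le_flux (hN : 0 ≤ N) (h : IsProfile N p A M P) {x : ℝ} (hx : x ∈ Ioo (0:ℝ) 1) :
    (A - M x) * (A + M x - 2 - 2 * N) ≤ 2 * x * (1 - x) * P x := by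
  have hT : Tendsto (fun y => (A - M y) * (A + M y - 2 - 2 * N) - 2 * y * (1 - y) * P y)
      (nhdsWithin 1 (Iio 1)) (nhds 0) := by
    have := ((h.lim.const_sub A).mul
      (((h.lim.const_add A).sub_const 2).sub_const (2 * N))).sub (h.tendsto_flux hN)
    simpa using this
  have : (A - M x) * (A + M x - 2 - 2 * N) - 2 * x * (1 - x) * P x ≤ 0 := by
    refine ge_of_tendsto hT ?_
    filter_upwards [Ico_mem_nhdsLT hx.2] with y hy
    have hsub : Icc x y ⊆ Ico 0 1 := fun z hz => ⟨hx.1.le.trans hz.1, hz.2.trans_lt hy.2⟩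
    have hM := h.contM.mono hsub
    refine le_of_hasDerivAt_nonneg
      (g := fun z => (A - M z) * (A + M z - 2 - 2 * N) - 2 * z * (1 - z) * P z)
      (g' := fun z => 2 * N * P z * (1 - z)) hy.1
      (ContinuousOn.sub (by fun_prop) (h.continuousOn_flux.mono hsub))
      (fun z hz => ?_) (fun z hz => ?_)
    · have hz' : z ∈ Ioo (0:ℝ) 1 := ⟨hx.1.trans hz.1, hz.2.trans hy.2⟩
      have hd := h.derivM z hz'
      refine (((hd.const_sub A).mul
        (((hd.const_add A).sub_const 2).sub_const (2 * N))).sub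
        (h.hasDerivAt_flux hz')).congr_deriv ?_
      ring
    · have := h.pos z ⟨hx.1.le.trans hz.1.le, hz.2.trans hy.2⟩
      have : 0 ≤ 1 - z := by linarith [hz.2, hy.2]
      positivity
  linarith

theorem lt_total_add (hN : 0 ≤ N) (h : IsProfile N p A M P) {x : ℝ} (hx : x ∈ Ioo (0:ℝ) 1) :
    2 + 2 * N * x < A + M x := by
  have h1 := (h.flux_pos hx).trans_le (h.flux_le_tail hN hx)
  have h2 := h.lt_total ⟨hx.1.le, hx.2⟩
  have := pos_of_mul_pos_right h1 (by linarith : 0 ≤ A - M x)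
  linarith

theorem add_one_lt_total (hN : 0 ≤ N) (h : IsProfile N p A M P) : N + 1 < A := by
  by_contra! hA
  have key : ∀ y ∈ Ico (1 / 2 : ℝ) 1,
      (A - M (1 / 2)) * exp (2 * N * (1 / 2)) ≤ (A - M y) * exp (2 * N * y) := by
    intro y hy
    have hsub : Icc (1 / 2) y ⊆ Ico (0:ℝ) 1 :=
      fun z hz => ⟨by linarith [hz.1], hz.2.trans_lt hy.2⟩
    have hM := h.contM.mono hsub
    refine le_of_hasDerivAt_nonneg (g := fun z => (A - M z) * exp (2 * N * z))
      (g' := fun z => (2 * N * (A - M z) - P z) * exp (2 * N * z)) hy.1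
      (by fun_prop) (fun z hz => ?_) (fun z hz => ?_)
    · have hd := h.derivM z ⟨by linarith [hz.1], hz.2.trans hy.2⟩
      refine ((hd.const_sub A).mul ((hasDerivAt_id z).const_mul (2 * N)).exp).congr_deriv ?_
      simp
      ring
    · have hz' : z ∈ Ioo (0:ℝ) 1 := ⟨by linarith [hz.1], hz.2.trans hy.2⟩
      have h1 := h.flux_le_tail hN hz'
      have h2 := h.lt_total ⟨hz'.1.le, hz'.2⟩
      have h3 := h.pos z ⟨hz'.1.le, hz'.2⟩
      have hz1 : 0 < 1 - z := by linarith [hz'.2]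
      have h4 : (A - M z) * (A + M z - 2 - 2 * N * z) ≤ (A - M z) * (2 * N * (1 - z)) :=
        mul_le_mul_of_nonneg_left (by linarith) (by linarith)
      have h5 : (1 - z) * P z ≤ 2 * z * (1 - z) * P z := by
        have := mul_nonneg (mul_nonneg (by linarith [hz.1] : (0:ℝ) ≤ 2 * z - 1) hz1.le) h3.le
        linarith
      have h6 : (1 - z) * P z ≤ (1 - z) * (2 * N * (A - M z)) := by linarith
      have := le_of_mul_le_mul_left h6 hz1
      exact mul_nonneg (by linarith) (exp_pos _).le
  have hT : Tendsto (fun y => (A - M y) * exp (2 * N * y)) (nhdsWithin 1 (Iio 1)) (nhds 0) := by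
    have hc : Continuous fun y : ℝ => exp (2 * N * y) := by fun_prop
    simpa using (h.lim.const_sub A).mul ((hc.tendsto 1).mono_left nhdsWithin_le_nhds)
  have h0 := ge_of_tendsto hT (by
    filter_upwards [Ico_mem_nhdsLT (by norm_num : (1 / 2 : ℝ) < 1)] with y hy using key y hy)
  have h1 := h.lt_total (x := 1 / 2) (by norm_num)
  exact absurd h0 (not_le.2 (mul_pos (by linarith) (exp_pos _)))

/-- The density grows at most like `(1 - x)^{-(N + 2)}`. -/
theorem density_mul_le (h : IsProfile N p A M P) {x y : ℝ} (hx : 0 ≤ x) (hxy : x ≤ y)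
    (hy : y < 1) : P y * (1 - y) ^ (N + 2) ≤ P x * (1 - x) ^ (N + 2) := by
  have hsub : Icc x y ⊆ Ico 0 1 := fun z hz => ⟨hx.trans hz.1, hz.2.trans_lt hy⟩
  have hP := h.contP.mono hsub
  have := le_of_hasDerivAt_nonneg (g := fun z => -(P z * (1 - z) ^ (N + 2)))
    (g' := fun z => P z * M z / (z * (1 - z)) * (1 - z) ^ (N + 2)) hxy
    ((hP.mul (ContinuousOn.rpow_const (by fun_prop)
      fun z hz => Or.inl (by linarith [(hsub hz).2]))).neg) (fun z hz => ?_) (fun z hz => ?_)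
  · simpa using this
  · have hz' : z ∈ Ioo (0:ℝ) 1 := ⟨hx.trans_lt hz.1, hz.2.trans hy⟩
    have hz1 : 0 < 1 - z := by linarith [hz'.2]
    have hr := ((hasDerivAt_id z).const_sub 1).rpow_const (p := N + 2) (Or.inl hz1.ne')
    refine ((h.derivP z hz').mul hr).neg.congr_deriv ?_
    have := hz'.1.ne'
    simp only [id]
    rw [rpow_sub_one hz1.ne']
    field_simp
    ring
  · have hz' : z ∈ Ico (0:ℝ) 1 := ⟨hx.trans hz.1.le, hz.2.trans hy⟩
    have hz1 : 0 < 1 - z := by linarith [hz'.2]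
    have := h.pos z hz'
    have := h.nonneg hz'
    have := hz'.1
    positivity

theorem density_le (hN : 0 ≤ N) (h : IsProfile N p A M P) {w x y : ℝ} (hx : 0 ≤ x) (hxy : x ≤ y)
    (hyw : y ≤ w) (hw : w < 1) : P y ≤ P x * ((1 - w) ^ (N + 2))⁻¹ := by
  have h1 := h.density_mul_le hx hxy (hyw.trans_lt hw)
  have hw0 : 0 < (1 - w) ^ (N + 2) := rpow_pos_of_pos (by linarith) _
  have h2 : (1 - w) ^ (N + 2) ≤ (1 - y) ^ (N + 2) :=
    rpow_le_rpow (by linarith) (by linarith) (by linarith)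
  have h3 : (1 - x) ^ (N + 2) ≤ 1 := rpow_le_one (by linarith) (by linarith) (by linarith)
  have hPx := h.pos x ⟨hx, by linarith⟩
  have hPy := h.pos y ⟨by linarith, by linarith⟩
  rw [← div_eq_mul_inv, le_div_iff₀ hw0]
  have := mul_le_mul_of_nonneg_left h2 hPy.le
  have := mul_le_mul_of_nonneg_left h3 hPx.le
  linarith

theorem mass_sub_le (h : IsProfile N p A M P) {x y B : ℝ} (hx : 0 ≤ x) (hxy : x ≤ y)
    (hy : y < 1) (hB : ∀ z ∈ Icc x y, P z ≤ B) : M y - M x ≤ B * (y - x) := by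
  have hsub : Icc x y ⊆ Ico 0 1 := fun z hz => ⟨hx.trans hz.1, hz.2.trans_lt hy⟩
  have hM := h.contM.mono hsub
  have := le_of_hasDerivAt_nonneg (g := fun z => B * z - M z) (g' := fun z => B - P z) hxy
    (by fun_prop)
    (fun z hz => (((hasDerivAt_id z).const_mul B).sub
        (h.derivM z ⟨hx.trans_lt hz.1, hz.2.trans hy⟩)).congr_deriv (by ring))
    (fun z hz => by linarith [hB z ⟨hz.1.le, hz.2.le⟩])
  linarith

theorem mass_le_mul (hN : 0 ≤ N) (h : IsProfile N p A M P) {x y : ℝ} (hx : 0 ≤ x) (hxy : x ≤ y)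
    (hy : y < 1) : M x ≤ p * ((1 - y) ^ (N + 2))⁻¹ * x := by
  have := h.mass_sub_le le_rfl hx (hxy.trans_lt hy) (B := p * ((1 - y) ^ (N + 2))⁻¹)
    fun z hz => by simpa [h.P_zero] using h.density_le hN le_rfl hz.1 (hz.2.trans hxy) hy
  simpa [h.M_zero] using this

theorem mass_le (hN : 0 ≤ N) (h : IsProfile N p A M P) {x : ℝ} (hx : x ∈ Ioo (0:ℝ) 1) :
    M x ≤ 2 + 2 * N * x := by
  have hsub : Icc 0 x ⊆ Ico 0 1 := fun z hz => ⟨hz.1, hz.2.trans_lt hx.2⟩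
  have hM := h.contM.mono hsub
  have := le_of_hasDerivAt_nonneg
    (g := fun z => 2 * M z - M z ^ 2 + 2 * N * z * M z - 2 * z * (1 - z) * P z)
    (g' := fun z => 2 * N * M z) hx.1.le
    (ContinuousOn.sub (by fun_prop) (h.continuousOn_flux.mono hsub))
    (fun z hz => by
      have hz' : z ∈ Ioo (0:ℝ) 1 := ⟨hz.1, hz.2.trans hx.2⟩
      have hd := h.derivM z hz'
      refine ((((hd.const_mul 2).sub (hd.pow 2)).add
        (((hasDerivAt_id z).const_mul (2 * N)).mul hd)).sub (h.hasDerivAt_flux hz')).congr_deriv ?_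
      simp
      ring)
    (fun z hz => by
      have := h.nonneg (x := z) ⟨hz.1.le, hz.2.trans hx.2⟩
      positivity)
  simp only [h.M_zero] at this
  have h1 := h.flux_pos hx
  have h2 : 0 < M x := by simpa [h.M_zero] using h.lt le_rfl hx.1 hx.2
  have h3 : 0 < M x * (2 + 2 * N * x - M x) := by nlinarith
  linarith [pos_of_mul_pos_right h3 h2.le]

theorem le_flux (hN : 0 ≤ N) (h : IsProfile N p A M P) {x : ℝ} (hx : x ∈ Ioo (0:ℝ) 1) :
    2 * M x - M x ^ 2 ≤ 2 * x * (1 - x) * P x := by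
  have hsub : Icc 0 x ⊆ Ico 0 1 := fun z hz => ⟨hz.1, hz.2.trans_lt hx.2⟩
  have hM := h.contM.mono hsub
  have := le_of_hasDerivAt_nonneg
    (g := fun z => 2 * z * (1 - z) * P z - (2 * M z - M z ^ 2))
    (g' := fun z => 2 * N * z * P z) hx.1.le
    ((h.continuousOn_flux.mono hsub).sub (by fun_prop))
    (fun z hz => by
      have hz' : z ∈ Ioo (0:ℝ) 1 := ⟨hz.1, hz.2.trans hx.2⟩
      have hd := h.derivM z hz'
      refine ((h.hasDerivAt_flux hz').sub ((hd.const_mul 2).sub (hd.pow 2))).congr_deriv ?_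
      simp
      ring)
    (fun z hz => by
      have := h.pos z ⟨hz.1.le, hz.2.trans hx.2⟩
      have := hz.1
      positivity)
  simp only [h.M_zero] at this
  linarith

/-- While the accumulated mass is at most `3/2`, the density stays comparable to its
initial value. -/
theorem le_density (hN : 0 ≤ N) (h : IsProfile N p A M P) {x : ℝ} (hx : x ∈ Ico (0:ℝ) 1)
    (hMx : M x ≤ 3 / 2) : p / 16 ≤ P x := by
  have hsub : Icc 0 x ⊆ Ico 0 1 := fun z hz => ⟨hz.1, hz.2.trans_lt hx.2⟩
  have hM := h.contM.mono hsub
  have hP := h.contP.mono hsub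
  have hpos : ∀ z ∈ Icc 0 x, 1 / 4 ≤ 1 - M z / 2 := by
    intro z hz
    have : M z ≤ M x := by
      rcases hz.2.eq_or_lt with h0 | h0
      · rw [h0]
      · exact (h.lt hz.1 h0 hx.2).le
    linarith
  have := le_of_hasDerivAt_nonneg
    (g := fun z => P z / (1 - M z / 2) ^ 2)
    (g' := fun z => P z * ((N + 2) * z * (1 - M z / 2) +
      (z * (1 - z) * P z - M z * (1 - M z / 2))) / (z * (1 - z) * (1 - M z / 2) ^ 3)) hx.1
    (hP.div (by fun_prop) fun z hz => by
      have := hpos z hz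
      positivity)
    (fun z hz => by
      have hz' : z ∈ Ioo (0:ℝ) 1 := ⟨hz.1, hz.2.trans hx.2⟩
      have h1 : 0 < 1 - M z / 2 := by linarith [hpos z ⟨hz.1.le, hz.2.le⟩]
      have hd := (((h.derivM z hz').div_const 2).const_sub 1).pow 2
      refine ((h.derivP z hz').div hd (pow_ne_zero 2 h1.ne')).congr_deriv ?_
      have := hz'.1.ne'
      have : 1 - z ≠ 0 := by linarith [hz'.2]
      simp
      field_simp
      ring)
    (fun z hz => by
      have hz' : z ∈ Ioo (0:ℝ) 1 := ⟨hz.1, hz.2.trans hx.2⟩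
      have h1 : 0 < 1 - M z / 2 := by linarith [hpos z ⟨hz.1.le, hz.2.le⟩]
      have h2 := h.le_flux hN hz'
      have h3 := h.pos z ⟨hz'.1.le, hz'.2⟩
      have h4 : 0 ≤ z * (1 - z) * P z - M z * (1 - M z / 2) := by nlinarith
      have h5 : 0 < 1 - z := by linarith [hz'.2]
      have := hz'.1
      positivity)
  simp only [h.M_zero, h.P_zero] at this
  have h1 := hpos x ⟨hx.1, le_rfl⟩
  have h2 := h.pos x hx
  rw [le_div_iff₀ (by positivity)] at this
  norm_num at this
  have h3 : (1 / 4) ^ 2 ≤ (1 - M x / 2) ^ 2 := by gcongr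
  nlinarith [h.p_pos]

theorem le_mass_of_large (hN : 0 ≤ N) (h : IsProfile N p A M P) {x : ℝ} (hx : x ∈ Ioo (0:ℝ) 1)
    (hpx : 32 ≤ p * x) : 3 / 2 ≤ M x := by
  by_contra! hlt
  have hsub : Icc 0 x ⊆ Ico 0 1 := fun z hz => ⟨hz.1, hz.2.trans_lt hx.2⟩
  have hM := h.contM.mono hsub
  have := le_of_hasDerivAt_nonneg (g := fun z => M z - p / 16 * z)
    (g' := fun z => P z - p / 16) hx.1.le (by fun_prop)
    (fun z hz => ((h.derivM z ⟨hz.1, hz.2.trans hx.2⟩).sub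
      ((hasDerivAt_id z).const_mul (p / 16))).congr_deriv (by ring))
    (fun z hz => by
      linarith [h.le_density hN ⟨hz.1.le, hz.2.trans hx.2⟩
        ((h.lt hz.1.le hz.2 hx.2).le.trans hlt.le)])
  simp only [h.M_zero] at this
  linarith

/-- After mass `3/2` has been accumulated, the density decays like `x^{-5/4}`. -/
theorem density_decay (h : IsProfile N p A M P) {x y : ℝ} (hx : 0 < x) (hxy : x ≤ y)
    (hy : y < 1) (hNy : (N + 2) * y ≤ 1 / 4) (hN : 0 ≤ N) (hMx : 3 / 2 ≤ M x) :
    P y * y ^ (5 / 4 : ℝ) ≤ P x * x ^ (5 / 4 : ℝ) := by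
  have hsub : Icc x y ⊆ Ico 0 1 := fun z hz => ⟨hx.le.trans hz.1, hz.2.trans_lt hy⟩
  have hP := h.contP.mono hsub
  have := le_of_hasDerivAt_nonneg (g := fun z => -(P z * z ^ (5 / 4 : ℝ)))
    (g' := fun z => P z * (M z - (N + 2) * z - 5 / 4 * (1 - z)) / (z * (1 - z))
      * z ^ (5 / 4 : ℝ)) hxy
    ((hP.mul (ContinuousOn.rpow_const (by fun_prop)
      fun z hz => Or.inr (by norm_num))).neg) (fun z hz => ?_) (fun z hz => ?_)
  · simpa using this
  · have hz' : z ∈ Ioo (0:ℝ) 1 := ⟨hx.trans hz.1, hz.2.trans hy⟩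
    have hz1 : 1 - z ≠ 0 := by linarith [hz'.2]
    have hz0 := hz'.1.ne'
    have hr := hasDerivAt_rpow_const (x := z) (p := 5 / 4) (Or.inl hz0)
    refine ((h.derivP z hz').mul hr).neg.congr_deriv ?_
    rw [rpow_sub_one hz0]
    field_simp
    ring
  · have hz' : z ∈ Ioo (0:ℝ) 1 := ⟨hx.trans hz.1, hz.2.trans hy⟩
    have hz1 : 0 < 1 - z := by linarith [hz'.2]
    have h1 := h.pos z ⟨hz'.1.le, hz'.2⟩
    have h2 := h.lt hx.le hz.1 hz'.2
    have h3 : (N + 2) * z ≤ (N + 2) * y := mul_le_mul_of_nonneg_left hz.2.le (by linarith)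
    have h4 : 0 ≤ M z - (N + 2) * z - 5 / 4 * (1 - z) := by linarith [hz'.1]
    have := hz'.1
    positivity

theorem exists_mass_le_of_large {N : ℝ} (hN : 0 ≤ N) {x η : ℝ} (hx : x ∈ Ioo (0:ℝ) 1)
    (hη : 0 < η) : ∃ q : ℝ, ∀ (p A : ℝ) (M P : ℝ → ℝ), q < p → IsProfile N p A M P →
      M x ≤ 2 + η := by
  obtain ⟨y, hy0, hyx, hyN, hyη⟩ : ∃ y : ℝ, 0 < y ∧ y ≤ x ∧ (N + 2) * y ≤ 1 / 4 ∧
      2 * N * y ≤ η / 2 := by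
    refine ⟨min x (min (1 / (4 * (N + 2))) (η / (4 * (N + 1)))), ?_, min_le_left _ _, ?_, ?_⟩
    · have := hx.1
      refine lt_min this (lt_min ?_ ?_) <;> positivity
    · calc _ ≤ (N + 2) * (1 / (4 * (N + 2))) := by
            gcongr
            exact (min_le_right _ _).trans (min_le_left _ _)
        _ = 1 / 4 := by field_simp
    · calc _ ≤ 2 * N * (η / (4 * (N + 1))) := by
            gcongr
            exact (min_le_right _ _).trans (min_le_right _ _)
        _ ≤ 2 * (N + 1) * (η / (4 * (N + 1))) := by gcongr; linarith
        _ = η / 2 := by field_simp; norm_num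
  have hy1 : y < 1 := hyx.trans_lt hx.2
  set W := ((1 - x) ^ (N + 2))⁻¹
  set V := (((1:ℝ) - 1 / 2) ^ (N + 2))⁻¹
  have hW : 0 < W := inv_pos.2 (rpow_pos_of_pos (by linarith [hx.2]) _)
  have hT : Tendsto (fun p : ℝ => V * 32 * (32 / p) ^ (1 / 4 : ℝ) / y ^ (5 / 4 : ℝ) * W)
      atTop (nhds 0) := by
    have h1 : Tendsto (fun p : ℝ => (32 / p) ^ (1 / 4 : ℝ)) atTop (nhds 0) := by
      have := (tendsto_const_nhds (x := (32 : ℝ))).div_atTop tendsto_id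
      simpa using this.rpow_const (p := 1 / 4) (Or.inr (by norm_num))
    simpa using ((h1.const_mul (V * 32)).div_const (y ^ (5 / 4 : ℝ))).mul_const W
  obtain ⟨q, hq⟩ := ((hT.eventually (gt_mem_nhds (half_pos hη))).and
    (eventually_gt_atTop (max 64 (32 / y)))).exists_forall_of_atTop
  refine ⟨q, fun p A M P hp h => ?_⟩
  obtain ⟨hq1, hq2⟩ := hq p hp.le
  have hp64 : 64 < p := (le_max_left _ _).trans_lt hq2
  have hp0 : 0 < p := by linarith
  have hpy : 32 / p ≤ y := by
    have := ((le_max_right _ _).trans_lt hq2).le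
    rw [div_le_iff₀ hy0] at this
    rw [div_le_iff₀ hp0]
    linarith
  have hx1 : 0 < 32 / p := by positivity
  have hhalf : 32 / p ≤ 1 / 2 := by
    rw [div_le_iff₀ hp0]; linarith
  have h1 := h.le_mass_of_large hN ⟨hx1, hpy.trans_lt hy1⟩ (by field_simp; rfl)
  have h2 := h.density_decay hx1 hpy hy1 hyN hN h1
  have h3 := h.density_le hN le_rfl hx1.le hhalf (by norm_num)
  rw [h.P_zero] at h3
  change _ ≤ p * V at h3
  have hye : 0 < y ^ (5 / 4 : ℝ) := rpow_pos_of_pos hy0 _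
  have h4 : P y ≤ V * 32 * (32 / p) ^ (1 / 4 : ℝ) / y ^ (5 / 4 : ℝ) := by
    rw [le_div_iff₀ hye]
    refine h2.trans ((mul_le_mul_of_nonneg_right h3 (rpow_nonneg hx1.le _)).trans_eq ?_)
    rw [show (5 / 4 : ℝ) = 1 + 1 / 4 by norm_num, rpow_add hx1, rpow_one]
    field_simp
  have hPy := h.pos y ⟨hy0.le, hy1⟩
  have h5 := h.mass_sub_le hy0.le hyx hx.2 (B := P y * W)
    fun z hz => h.density_le hN hy0.le hz.1 hz.2 hx.2
  have h6 : P y * W * (x - y) ≤ P y * W :=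
    mul_le_of_le_one_right (by positivity) (by linarith [hx.2])
  have h7 := h.mass_le hN ⟨hy0, hy1⟩
  have h8 := mul_le_mul_of_nonneg_right h4 hW.le
  linarith

/-- At both ends of the parameter range the total mass exceeds any level below `2N`. -/
theorem exists_lt_total {N c : ℝ} (hN : 0 < N) (hc : c < 2 * N) :
    ∃ q₁ q₂ : ℝ, 0 < q₁ ∧ ∀ (p A : ℝ) (M P : ℝ → ℝ), p < q₁ ∨ q₂ < p → IsProfile N p A M P →
      c < A := by
  set t := min (1 / 2) ((2 * N - c) / (2 * N + 1)) with ht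
  have ht0 : 0 < t := lt_min (by norm_num) (div_pos (by linarith) (by linarith))
  have ht1 : t ≤ 1 / 2 := min_le_left _ _
  have ht2 : t * (2 * N + 1) ≤ 2 * N - c := by
    rw [← le_div_iff₀ (by linarith)]
    exact min_le_right _ _
  have hx : 1 - t ∈ Ioo (0:ℝ) 1 := ⟨by linarith, by linarith⟩
  obtain ⟨q, hq⟩ := exists_mass_le_of_large hN.le hx ht0
  have hr : 0 < (1 - (1 - t)) ^ (N + 2) := rpow_pos_of_pos (by linarith) _
  refine ⟨(1 - (1 - t)) ^ (N + 2), q, hr, fun p A M P hp h => ?_⟩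
  have hM : M (1 - t) ≤ 2 + t := by
    rcases hp with hp | hp
    · have h1 := h.mass_le_mul hN.le hx.1.le le_rfl hx.2
      have h2 : p * ((1 - (1 - t)) ^ (N + 2))⁻¹ ≤ 1 := by
        rw [← div_eq_mul_inv, div_le_one hr]
        exact hp.le
      have := mul_le_mul_of_nonneg_right h2 hx.1.le
      linarith
    · exact hq p A M P hp h
  have := h.lt_total_add hN.le hx
  linarith

/-- Two profiles with initial densities at most `b` stay close on `[0, x]` if their initial
densities are close. -/
theorem dist_sq_le (hN : 0 ≤ N) {p' A' : ℝ} {M' P' : ℝ → ℝ} (h : IsProfile N p A M P)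
    (h' : IsProfile N p' A' M' P') {x b : ℝ} (hx : x ∈ Ioo (0:ℝ) 1) (hp : p ≤ b) (hp' : p' ≤ b) :
    (M x - M' x) ^ 2 + (log (P x) - log (P' x)) ^ 2 ≤ (log p - log p') ^ 2 *
      exp ((2 * (b * ((1 - x) ^ (N + 2))⁻¹) ^ 2 + 2 * ((1 - x)⁻¹) ^ 2) * x) := by
  set B := b * ((1 - x) ^ (N + 2))⁻¹ with hB
  set C := 2 * B ^ 2 + 2 * ((1 - x)⁻¹) ^ 2 with hC
  have hr : 0 < ((1 - x) ^ (N + 2))⁻¹ := inv_pos.2 (rpow_pos_of_pos (by linarith [hx.2]) _)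
  have bound : ∀ {p A : ℝ} {M P : ℝ → ℝ}, IsProfile N p A M P → p ≤ b → ∀ z ∈ Icc 0 x,
      P z ≤ B ∧ M z ≤ B * z := by
    intro p A M P h hp z hz
    have h1 := h.density_le hN le_rfl hz.1 hz.2 hx.2
    rw [h.P_zero] at h1
    have h2 := mul_le_mul_of_nonneg_right hp hr.le
    exact ⟨h1.trans h2, (h.mass_le_mul hN hz.1 hz.2 hx.2).trans
      (mul_le_mul_of_nonneg_right h2 hz.1)⟩
  have key : ∀ y ∈ Ioo 0 x,
      ((M x - M' x) ^ 2 / x + (log (P x) - log (P' x)) ^ 2) * exp (-(C * x)) ≤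
        B ^ 2 * y + (log (P y) - log (P' y)) ^ 2 := by
    intro y hy
    have hsub : Icc y x ⊆ Ico 0 1 := fun z hz => ⟨hy.1.le.trans hz.1, hz.2.trans_lt hx.2⟩
    have hM := h.contM.mono hsub
    have hM' := h'.contM.mono hsub
    have hP := (h.contP.mono hsub).log fun z hz => (h.pos z (hsub hz)).ne'
    have hP' := (h'.contP.mono hsub).log fun z hz => (h'.pos z (hsub hz)).ne'
    have hmono := le_of_hasDerivAt_nonneg
      (g := fun z => -(((M z - M' z) ^ 2 / z + (log (P z) - log (P' z)) ^ 2) * exp (-(C * z))))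
      (g' := fun z => (C * ((M z - M' z) ^ 2 / z + (log (P z) - log (P' z)) ^ 2)
        - (2 * ((M z - M' z) / z) * (P z - P' z) - ((M z - M' z) / z) ^ 2
          - 2 * (log (P z) - log (P' z)) * ((M z - M' z) / z) * (1 - z)⁻¹)) * exp (-(C * z)))
      hy.2.le ?_ (fun z hz => ?_) (fun z hz => ?_)
    · have hy' : y ∈ Icc 0 x := ⟨hy.1.le, hy.2.le⟩
      have h1 := bound h hp y hy'
      have h2 := bound h' hp' y hy'
      have h3 := h.nonneg (x := y) ⟨hy.1.le, hy.2.trans hx.2⟩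
      have h4 := h'.nonneg (x := y) ⟨hy.1.le, hy.2.trans hx.2⟩
      have h5 : (M y - M' y) ^ 2 / y ≤ B ^ 2 * y := by
        rw [div_le_iff₀ hy.1]
        have : (M y - M' y) ^ 2 ≤ (B * y) ^ 2 :=
          sq_le_sq' (by linarith) (by linarith)
        linarith
      have h6 : exp (-(C * y)) ≤ 1 := by
        rw [exp_le_one_iff]
        have := hy.1
        have : 0 ≤ C := by positivity
        have : 0 ≤ C * y := by positivity
        linarith
      have h7 : 0 ≤ (M y - M' y) ^ 2 / y + (log (P y) - log (P' y)) ^ 2 := by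
        have := hy.1
        positivity
      have h8 := mul_le_of_le_one_right h7 h6
      linarith
    · have hne : ∀ z ∈ Icc y x, z ≠ 0 := fun z hz => (hy.1.trans_le hz.1).ne'
      exact ((((hM.sub hM').pow 2).div continuousOn_id hne).add
        ((hP.sub hP').pow 2)).mul (by fun_prop) |>.neg
    · have hz' : z ∈ Ioo (0:ℝ) 1 := ⟨hy.1.trans hz.1, hz.2.trans hx.2⟩
      have hz0 := hz'.1.ne'
      have hz1 : 1 - z ≠ 0 := by linarith [hz'.2]
      have hPz := (h.pos z ⟨hz'.1.le, hz'.2⟩).ne'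
      have hPz' := (h'.pos z ⟨hz'.1.le, hz'.2⟩).ne'
      have d1 := (((h.derivM z hz').sub (h'.derivM z hz')).pow 2).div (hasDerivAt_id z) hz0
      have d2 := (((h.derivP z hz').log hPz).sub ((h'.derivP z hz').log hPz')).pow 2
      have d3 := (((hasDerivAt_id z).const_mul C).neg).exp
      refine (((d1.add d2).mul d3).neg).congr_deriv ?_
      simp
      field_simp
      ring
    · have hz' : z ∈ Ioo (0:ℝ) 1 := ⟨hy.1.trans hz.1, hz.2.trans hx.2⟩
      have hPz := h.pos z ⟨hz'.1.le, hz'.2⟩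
      have hPz' := h'.pos z ⟨hz'.1.le, hz'.2⟩
      have b1 := (bound h hp z ⟨hz'.1.le, hz.2.le⟩).1
      have b2 := (bound h' hp' z ⟨hz'.1.le, hz.2.le⟩).1
      set E := log (P z) - log (P' z)
      set D := (M z - M' z) / z with hD
      have hE : (P z - P' z) ^ 2 ≤ B ^ 2 * E ^ 2 := by
        have lip : ∀ s t : ℝ, 0 < s → 0 < t → s - t ≤ s * (log s - log t) := by
          intro s t hs ht
          have := log_le_sub_one_of_pos (div_pos ht hs)
          rw [log_div ht.ne' hs.ne'] at this
          have := mul_le_mul_of_nonneg_left this hs.le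
          have h3 : s * (t / s - 1) = t - s := by field_simp
          linarith
        have l1 := lip _ _ hPz hPz'
        have l2 := lip _ _ hPz' hPz
        have l3 : P z * E ≤ B * |E| :=
          (mul_le_mul_of_nonneg_left (le_abs_self E) hPz.le).trans
            (mul_le_mul_of_nonneg_right b1 (abs_nonneg E))
        have l4 : P' z * (-E) ≤ B * |E| :=
          (mul_le_mul_of_nonneg_left (neg_le_abs E) hPz'.le).trans
            (mul_le_mul_of_nonneg_right b2 (abs_nonneg E))
        have l5 : log (P' z) - log (P z) = -E := by ring
        rw [l5] at l2
        have : |P z - P' z| ≤ B * |E| := abs_le.2 ⟨by linarith, by linarith⟩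
        calc (P z - P' z) ^ 2 = |P z - P' z| ^ 2 := (sq_abs _).symm
          _ ≤ (B * |E|) ^ 2 := by gcongr
          _ = B ^ 2 * E ^ 2 := by rw [mul_pow, sq_abs]
      have hc : ((1 - z)⁻¹) ^ 2 ≤ ((1 - x)⁻¹) ^ 2 := by
        have : 0 < 1 - x := by linarith [hx.2]
        have : 0 < 1 - z := by linarith [hz'.2]
        have : 1 - x ≤ 1 - z := by linarith [hz.2]
        gcongr
      have hDz : 0 ≤ (M z - M' z) ^ 2 / z := by
        have := hz'.1
        positivity
      have hc' := mul_le_mul_of_nonneg_right hc (sq_nonneg E)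
      have hCD : 0 ≤ C * ((M z - M' z) ^ 2 / z) := by positivity
      refine mul_nonneg ?_ (exp_pos _).le
      have e1 := sq_nonneg (D - 2 * (P z - P' z))
      have e2 := sq_nonneg (D + 2 * E * (1 - z)⁻¹)
      have e3 : C * E ^ 2 = 2 * (B ^ 2 * E ^ 2) + 2 * (((1 - x)⁻¹) ^ 2 * E ^ 2) := by
        rw [hC]; ring
      linarith [mul_add C ((M z - M' z) ^ 2 / z) (E ^ 2)]
  have hT : Tendsto (fun y => B ^ 2 * y + (log (P y) - log (P' y)) ^ 2)
      (nhdsWithin 0 (Ioi 0)) (nhds ((log p - log p') ^ 2)) := by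
    have c0 : ∀ {p A : ℝ} {M P : ℝ → ℝ}, IsProfile N p A M P →
        Tendsto (fun y => log (P y)) (nhdsWithin 0 (Ioi 0)) (nhds (log p)) := by
      intro p A M P h
      have h1 : Tendsto P (nhdsWithin 0 (Ioi 0)) (nhds (P 0)) := by
        rw [← nhdsWithin_Ioo_eq_nhdsGT zero_lt_one]
        exact (h.contP 0 (by norm_num)).mono Ioo_subset_Ico_self
      rw [h.P_zero] at h1
      exact h1.log h.p_pos.ne'
    have c1 : Tendsto (fun y : ℝ => B ^ 2 * y) (nhdsWithin 0 (Ioi 0)) (nhds 0) := by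
      have : Continuous fun y : ℝ => B ^ 2 * y := by fun_prop
      simpa using (this.tendsto 0).mono_left nhdsWithin_le_nhds
    simpa using c1.add (((c0 h).sub (c0 h')).pow 2)
  have hfin := ge_of_tendsto hT (by
    filter_upwards [Ioo_mem_nhdsGT hx.1] with y hy using key y hy)
  have hx2 : (M x - M' x) ^ 2 ≤ (M x - M' x) ^ 2 / x := by
    rw [le_div_iff₀ hx.1]
    exact mul_le_of_le_one_right (sq_nonneg _) hx.2.le
  rw [exp_neg, ← div_eq_mul_inv, div_le_iff₀ (exp_pos _)] at hfin
  linarith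

/-- The profile with initial density `N + 2` is linear, of total mass `N + 2`. -/
theorem total_eq_of_linear (hN : 0 ≤ N) (h : IsProfile N (N + 2) A M P) : A = N + 2 := by
  have hM : ∀ x ∈ Ioo (0:ℝ) 1, M x = (N + 2) * x := by
    intro x hx
    have := h.dist_sq_le hN (isProfile_linear (by linarith)) hx le_rfl le_rfl
    simp only [sub_self, ne_eq, OfNat.ofNat_ne_zero, not_false_eq_true, zero_pow, zero_mul] at this
    have h1 : (M x - (N + 2) * x) ^ 2 ≤ 0 := by
      linarith [sq_nonneg (log (P x) - log (N + 2))]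
    linarith [pow_eq_zero_iff (two_ne_zero) |>.1 (le_antisymm h1 (sq_nonneg _))]
  refine tendsto_nhds_unique (h.lim.congr' ?_) (isProfile_linear (N := N) (by linarith)).lim
  filter_upwards [Ioo_mem_nhdsLT zero_lt_one] with x hx using hM x hx

/-- First-order quantity whose monotonicity compares a profile for `N = 2` with the
linear one. -/
theorem hasDerivAt_excess (h : IsProfile 2 p A M P) (c : ℝ) {x : ℝ} (hx : x ∈ Ioo (0:ℝ) 1) :
    HasDerivAt (fun z => ((P z - 4) * (z * (1 - z)) + (M z - 4 * z) ^ 2 / 2) * (1 - 2 * z + c)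
        - (M z - 4 * z) * (1 - 6 * z + 6 * z ^ 2 + c * (1 - 2 * z)))
      ((M x - 4 * x) * (2 - 4 * x - 2 * c - (M x - 4 * x))) x := by
  have hz := hasDerivAt_id x
  have dP := (h.derivP x hx).sub_const 4
  have dn := (h.derivM x hx).sub (hz.const_mul 4)
  refine ((((dP.mul (hz.mul (hz.const_sub 1))).add ((dn.pow 2).div_const 2)).mul
    (((hz.const_mul 2).const_sub 1).add_const c)).sub
    (dn.mul ((((hz.const_mul 6).const_sub 1).add ((hz.pow 2).const_mul 6)).add
      (((hz.const_mul 2).const_sub 1).const_mul c)))).congr_deriv ?_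
  have := hx.1.ne'
  have : 1 - x ≠ 0 := by linarith [hx.2]
  simp
  field_simp
  ring

theorem continuousOn_excess (h : IsProfile 2 p A M P) (c : ℝ) :
    ContinuousOn (fun z => ((P z - 4) * (z * (1 - z)) + (M z - 4 * z) ^ 2 / 2) * (1 - 2 * z + c)
        - (M z - 4 * z) * (1 - 6 * z + 6 * z ^ 2 + c * (1 - 2 * z))) (Ico 0 1) := by
  have := h.contP
  have := h.contM
  fun_prop

/-- Integrated form of the linearised equation tested against `x (1 - x)`. -/
theorem hasDerivAt_moment (h : IsProfile 2 p A M P) {x : ℝ} (hx : x ∈ Ioo (0:ℝ) 1) :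
    HasDerivAt (fun z => (M z - 4 * z) * (1 - 2 * z) - (P z - 4) * (z * (1 - z))
        - (M z - 4 * z) ^ 2 / 2) (2 * (M x - 4 * x)) x := by
  have hz := hasDerivAt_id x
  have dP := (h.derivP x hx).sub_const 4
  have dn := (h.derivM x hx).sub (hz.const_mul 4)
  refine (((dn.mul ((hz.const_mul 2).const_sub 1)).sub (dP.mul (hz.mul (hz.const_sub 1)))).sub
    ((dn.pow 2).div_const 2)).congr_deriv ?_
  have := hx.1.ne'
  have : 1 - x ≠ 0 := by linarith [hx.2]
  simp
  field_simp
  ring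

theorem continuousOn_moment (h : IsProfile 2 p A M P) :
    ContinuousOn (fun z => (M z - 4 * z) * (1 - 2 * z) - (P z - 4) * (z * (1 - z))
        - (M z - 4 * z) ^ 2 / 2) (Ico 0 1) := by
  have := h.contP
  have := h.contM
  fun_prop

theorem tendsto_flux_sub (hN : 0 ≤ N) (h : IsProfile N p A M P) :
    Tendsto (fun z => (P z - 4) * (z * (1 - z))) (nhdsWithin 1 (Iio 1)) (nhds 0) := by
  have h1 := (h.tendsto_flux hN).div_const 2
  have h2 : Tendsto (fun z : ℝ => 4 * (z * (1 - z))) (nhdsWithin 1 (Iio 1)) (nhds 0) := by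
    have : Continuous fun z : ℝ => 4 * (z * (1 - z)) := by fun_prop
    simpa using (this.tendsto 1).mono_left nhdsWithin_le_nhds
  have h3 := h1.sub h2
  simp only [zero_div, sub_zero] at h3
  refine h3.congr fun z => ?_
  ring

theorem tendsto_mass_sub (h : IsProfile N p A M P) :
    Tendsto (fun z => M z - 4 * z) (nhdsWithin 1 (Iio 1)) (nhds (A - 4)) := by
  have : Continuous fun z : ℝ => 4 * z := by fun_prop
  simpa using h.lim.sub ((this.tendsto 1).mono_left nhdsWithin_le_nhds)

/-- For `N = 2`, increasing the initial density beyond that of the linear profile pushes the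
total mass below `4`. -/
theorem total_lt_four (h : IsProfile 2 p A M P) (hp : 4 < p) : A < 4 := by
  have hN : (0:ℝ) ≤ 2 := by norm_num
  by_contra! hA
  have hcn : ContinuousOn (fun z => M z - 4 * z) (Ico 0 1) := h.contM.sub (by fun_prop)
  have hid : ∀ {f : ℝ → ℝ} {l : ℝ}, Continuous f → f 1 = l →
      Tendsto f (nhdsWithin 1 (Iio 1)) (nhds l) := by
    rintro f l hf rfl
    exact (hf.tendsto 1).mono_left nhdsWithin_le_nhds
  -- the excess mass is positive near the origin
  obtain ⟨e, he0, he1, he⟩ : ∃ e : ℝ, 0 < e ∧ e < 1 ∧ ∀ x ∈ Ioc 0 e, 0 < M x - 4 * x := by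
    have h1 : Tendsto P (nhdsWithin 0 (Ici 0)) (nhds (P 0)) := by
      rw [← nhdsWithin_Ico_eq_nhdsGE zero_lt_one]
      exact h.contP 0 (by norm_num)
    rw [h.P_zero] at h1
    obtain ⟨e, he, hsub⟩ := mem_nhdsGE_iff_exists_Ico_subset.1 (h1.eventually (lt_mem_nhds hp))
    have hd : 0 < min e (1 / 2) := lt_min he (by norm_num)
    refine ⟨min e (1 / 2) / 2, by linarith, by linarith [min_le_right e (1 / 2)], fun x hx => ?_⟩
    have hxe : x < e := by linarith [hx.2, min_le_left e (1 / 2)]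
    have hx1 : x < 1 := by linarith [hx.2, min_le_right e (1 / 2)]
    have := lt_of_hasDerivAt_pos (g := fun z => M z - 4 * z) (g' := fun z => P z - 4) hx.1
      (hcn.mono fun z hz => ⟨hz.1, hz.2.trans_lt hx1⟩)
      (fun z hz => ((h.derivM z ⟨hz.1, hz.2.trans hx1⟩).sub
        ((hasDerivAt_id z).const_mul 4)).congr_deriv (by ring))
      (fun z hz => sub_pos.2 (hsub ⟨hz.1.le, hz.2.trans hxe⟩))
    simpa [h.M_zero] using this
  -- it vanishes at some first point `a`
  obtain ⟨a, ha, ha0, hapos⟩ : ∃ a ∈ Ioo (0:ℝ) 1, M a - 4 * a = 0 ∧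
      ∀ x ∈ Ioo 0 a, 0 < M x - 4 * x := by
    by_cases hall : ∀ b ∈ Ico e 1, 0 < M b - 4 * b
    · exfalso
      have hT := ((h.tendsto_mass_sub.mul (hid (f := fun z => 1 - 2 * z) (by fun_prop)
        rfl)).sub (h.tendsto_flux_sub hN)).sub ((h.tendsto_mass_sub.pow 2).div_const 2)
      have hmono : ∀ x y : ℝ, 0 ≤ x → x < y → y < 1 →
          (M x - 4 * x) * (1 - 2 * x) - (P x - 4) * (x * (1 - x)) - (M x - 4 * x) ^ 2 / 2 <
          (M y - 4 * y) * (1 - 2 * y) - (P y - 4) * (y * (1 - y)) - (M y - 4 * y) ^ 2 / 2 := by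
        intro x y hx hxy hy
        refine lt_of_hasDerivAt_pos hxy (h.continuousOn_moment.mono
          fun z hz => ⟨hx.trans hz.1, hz.2.trans_lt hy⟩)
          (fun z hz => h.hasDerivAt_moment ⟨hx.trans_lt hz.1, hz.2.trans hy⟩) fun z hz => ?_
        rcases le_total z e with hze | hze
        · linarith [he z ⟨hx.trans_lt hz.1, hze⟩]
        · linarith [hall z ⟨hze, hz.2.trans hy⟩]
      have h1 := hmono 0 (1 / 2) le_rfl (by norm_num) (by norm_num)
      simp only [h.M_zero] at h1
      have h2 := ge_of_tendsto hT (by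
        filter_upwards [Ioo_mem_nhdsLT (by norm_num : (1 / 2 : ℝ) < 1)] with y hy using
          (hmono (1 / 2) y (by norm_num) hy.1 hy.2).le)
      nlinarith [sq_nonneg (A - 4)]
    · push Not at hall
      obtain ⟨b, hb, hb0⟩ := hall
      obtain ⟨a, ha, ha0, hlt⟩ := exists_first_zero (g := fun z => -(M z - 4 * z)) hb.1
        (hcn.neg.mono fun z hz => ⟨he0.le.trans hz.1, hz.2.trans_lt hb.2⟩)
        (by simpa using he e ⟨he0, le_rfl⟩) (by simpa using hb0)
      refine ⟨a, ⟨he0.trans ha.1, ha.2.trans_lt hb.2⟩, neg_eq_zero.1 ha0, fun x hx => ?_⟩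
      rcases le_total x e with hxe | hxe
      · exact he x ⟨hx.1, hxe⟩
      · exact neg_lt_zero.1 (hlt x ⟨hxe, hx.2⟩)
  have hMa : M a = 4 * a := by linarith
  have hsuba : Icc 0 a ⊆ Ico 0 1 := fun z hz => ⟨hz.1, hz.2.trans_lt ha.2⟩
  -- the density at `a` is below that of the linear profile
  have hPa : P a < 4 := by
    have := lt_of_hasDerivAt_pos ha.1 (h.continuousOn_moment.mono hsuba)
      (fun z hz => h.hasDerivAt_moment ⟨hz.1, hz.2.trans ha.2⟩)
      (fun z hz => by linarith [hapos z hz])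
    simp only [h.M_zero, ha0] at this
    have h1 : 0 < a * (1 - a) := mul_pos ha.1 (by linarith [ha.2])
    nlinarith
  have hahalf : 1 / 2 < a := by
    by_contra! hle
    have := lt_of_hasDerivAt_pos ha.1 ((h.continuousOn_excess (2 * a - 1)).mono hsuba)
      (fun z hz => h.hasDerivAt_excess (2 * a - 1) ⟨hz.1, hz.2.trans ha.2⟩)
      (fun z hz => mul_pos (hapos z hz) (by linarith [h.lt hz.1.le hz.2 ha.2]))
    simp only [h.M_zero, ha0] at this
    ring_nf at this
    exact lt_irrefl _ this
  -- monotonicity of the excess as long as there is no second zero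
  have hexc : ∀ x y : ℝ, 0 ≤ x → x < y → y < 1 → (∀ z ∈ Ioo x y,
      (M z - 4 * z) * (2 - 4 * z - 2 * (1 - 2 * a) - (M z - 4 * z)) > 0) →
      ((P x - 4) * (x * (1 - x)) + (M x - 4 * x) ^ 2 / 2) * (1 - 2 * x + (1 - 2 * a))
        - (M x - 4 * x) * (1 - 6 * x + 6 * x ^ 2 + (1 - 2 * a) * (1 - 2 * x)) <
      ((P y - 4) * (y * (1 - y)) + (M y - 4 * y) ^ 2 / 2) * (1 - 2 * y + (1 - 2 * a))
        - (M y - 4 * y) * (1 - 6 * y + 6 * y ^ 2 + (1 - 2 * a) * (1 - 2 * y)) := by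
    intro x y hx hxy hy hz
    exact lt_of_hasDerivAt_pos hxy ((h.continuousOn_excess (1 - 2 * a)).mono
      fun z hz => ⟨hx.trans hz.1, hz.2.trans_lt hy⟩)
      (fun z hz => h.hasDerivAt_excess (1 - 2 * a) ⟨hx.trans_lt hz.1, hz.2.trans hy⟩) hz
  have hleft : 0 < (P a - 4) * (a * (1 - a)) * (2 - 4 * a) := by
    have := hexc 0 a le_rfl ha.1 ha.2 fun z hz =>
      mul_pos (hapos z hz) (by linarith [h.lt hz.1.le hz.2 ha.2])
    simp only [h.M_zero, ha0] at this
    ring_nf at this ⊢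
    linarith
  -- the excess mass is negative just after `a`
  obtain ⟨e', hae', he1', hne'⟩ : ∃ e', a < e' ∧ e' < 1 ∧ ∀ x ∈ Ioc a e', M x - 4 * x < 0 := by
    have h1 : Tendsto P (nhdsWithin a (Ici a)) (nhds (P a)) := by
      rw [← nhdsWithin_Ico_eq_nhdsGE ha.2]
      exact (h.contP a ⟨ha.1.le, ha.2⟩).mono fun z hz => ⟨ha.1.le.trans hz.1, hz.2⟩
    obtain ⟨d, hd, hsub⟩ := mem_nhdsGE_iff_exists_Ico_subset.1 (h1.eventually (gt_mem_nhds hPa))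
    have hd' : a < min d 1 := lt_min hd ha.2
    refine ⟨(a + min d 1) / 2, by linarith, by linarith [min_le_right d 1, ha.2], fun x hx => ?_⟩
    have hxd : x < d := by linarith [hx.2, min_le_left d 1]
    have hx1 : x < 1 := by linarith [hx.2, min_le_right d 1]
    have := lt_of_hasDerivAt_pos (g := fun z => -(M z - 4 * z)) (g' := fun z => -(P z - 4)) hx.1
      (hcn.neg.mono fun z hz => ⟨ha.1.le.trans hz.1, hz.2.trans_lt hx1⟩)
      (fun z hz => ((h.derivM z ⟨ha.1.trans hz.1, hz.2.trans hx1⟩).sub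
        ((hasDerivAt_id z).const_mul 4)).neg.congr_deriv (by ring))
      (fun z hz => by
        have : P z < 4 := hsub ⟨hz.1.le, hz.2.trans hxd⟩
        linarith)
    simp only [ha0] at this
    linarith
  have hright : ∀ z : ℝ, a < z → z < 1 → M z - 4 * z < 0 →
      (M z - 4 * z) * (2 - 4 * z - 2 * (1 - 2 * a) - (M z - 4 * z)) > 0 := by
    intro z haz hz1 hz
    exact mul_pos_of_neg_of_neg hz (by linarith [h.lt ha.1.le haz hz1])
  by_cases hall : ∀ b ∈ Ico e' 1, M b - 4 * b < 0
  · have hnegall : ∀ z, a < z → z < 1 → M z - 4 * z < 0 := by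
      intro z hz hz1
      rcases le_total z e' with hze | hze
      · exact hne' z ⟨hz, hze⟩
      · exact hall z ⟨hze, hz1⟩
    have hA4 : A - 4 ≤ 0 := le_of_tendsto h.tendsto_mass_sub (by
      filter_upwards [Ioo_mem_nhdsLT ha.2] with z hz using (hnegall z hz.1 hz.2).le)
    have hA0 : A - 4 = 0 := by linarith
    have hT := (((h.tendsto_flux_sub hN).add ((h.tendsto_mass_sub.pow 2).div_const 2)).mul
      (hid (f := fun z => 1 - 2 * z + (1 - 2 * a)) (by fun_prop) rfl)).sub
      (h.tendsto_mass_sub.mul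
        (hid (f := fun z => 1 - 6 * z + 6 * z ^ 2 + (1 - 2 * a) * (1 - 2 * z)) (by fun_prop) rfl))
    rw [hA0] at hT
    have h1 := ge_of_tendsto hT (by
      filter_upwards [Ioo_mem_nhdsLT ha.2] with y hy using
        (hexc a y ha.1.le hy.1 hy.2 fun z hz => hright z hz.1 (hz.2.trans hy.2)
          (hnegall z hz.1 (hz.2.trans hy.2))).le)
    simp only [ha0] at h1
    ring_nf at h1 hleft
    linarith
  · push Not at hall
    obtain ⟨b, hb, hb0⟩ := hall
    obtain ⟨c, hc, hc0, hlt⟩ := exists_first_zero (g := fun z => M z - 4 * z) hb.1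
      (hcn.mono fun z hz => ⟨(ha.1.trans hae').le.trans hz.1, hz.2.trans_lt hb.2⟩)
      (hne' e' ⟨hae', le_rfl⟩) hb0
    have hac : a < c := hae'.trans hc.1
    have hc1 : c < 1 := hc.2.trans_lt hb.2
    have hneg : ∀ z, a < z → z < c → M z - 4 * z < 0 := by
      intro z hz hzc
      rcases le_total z e' with hze | hze
      · exact hne' z ⟨hz, hze⟩
      · exact hlt z ⟨hze, hzc⟩
    have h1 := hexc a c ha.1.le hac hc1 fun z hz => hright z hz.1 (hz.2.trans hc1)
      (hneg z hz.1 hz.2)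
    have hPc : 4 ≤ P c := by
      by_contra! hlt4
      have h2 : Tendsto P (nhdsWithin c (Iic c)) (nhds (P c)) := by
        rw [← nhdsWithin_Icc_eq_nhdsLE (ha.1.trans hac)]
        exact (h.contP c ⟨(ha.1.trans hac).le, hc1⟩).mono fun z hz => ⟨hz.1, hz.2.trans_lt hc1⟩
      obtain ⟨d, hd, hsub⟩ := mem_nhdsLE_iff_exists_Ioc_subset.1
        (h2.eventually (gt_mem_nhds hlt4))
      have hdc : max d a < c := max_lt hd hac
      set y := (max d a + c) / 2 with hy
      have hyc : y < c := by linarith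
      have hyd : d < y := by linarith [le_max_left d a]
      have hya : a < y := by linarith [le_max_right d a]
      have := lt_of_hasDerivAt_pos (g := fun z => -(M z - 4 * z)) (g' := fun z => -(P z - 4)) hyc
        (hcn.neg.mono fun z hz => ⟨(ha.1.trans hya).le.trans hz.1, hz.2.trans_lt hc1⟩)
        (fun z hz => ((h.derivM z ⟨(ha.1.trans hya).trans hz.1, hz.2.trans hc1⟩).sub
          ((hasDerivAt_id z).const_mul 4)).neg.congr_deriv (by ring))
        (fun z hz => by
          have : P z < 4 := hsub ⟨hyd.trans hz.1, hz.2.le⟩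
          linarith)
      simp only [hc0] at this
      linarith [hneg y hya hyc]
    simp only [ha0, hc0] at h1
    have h2 : 0 ≤ (P c - 4) * (c * (1 - c)) := by
      have := ha.1
      have : 0 < 1 - c := by linarith
      have : 0 ≤ P c - 4 := by linarith
      have : 0 < c := by linarith
      positivity
    have h3 : (P c - 4) * (c * (1 - c)) * (2 - 2 * c - 2 * a) ≤ 0 :=
      mul_nonpos_of_nonneg_of_nonpos h2 (by linarith)
    ring_nf at h1 h3 hleft
    linarith

end IsProfile

section Family

variable {N : ℝ} {α : ℝ → ℝ} {M P : ℝ → ℝ → ℝ}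

theorem tendsto_of_family (hN : 0 ≤ N)
    (h : ∀ a, IsProfile N (exp (2 * a) / 2) (α a) (M a) (P a)) (a₀ : ℝ) {x : ℝ}
    (hx : x ∈ Ioo (0:ℝ) 1) :
    Tendsto (fun a => M a x) (nhds a₀) (nhds (M a₀ x)) ∧
      Tendsto (fun a => P a x) (nhds a₀) (nhds (P a₀ x)) := by
  obtain ⟨K, hK⟩ : ∃ K : ℝ, ∀ a < a₀ + 1, (M a x - M a₀ x) ^ 2 +
      (log (P a x) - log (P a₀ x)) ^ 2 ≤ (2 * (a - a₀)) ^ 2 * K := by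
    refine ⟨exp ((2 * (exp (2 * (a₀ + 1)) / 2 * ((1 - x) ^ (N + 2))⁻¹) ^ 2 +
      2 * ((1 - x)⁻¹) ^ 2) * x), fun a ha => ?_⟩
    have := (h a).dist_sq_le hN (h a₀) hx (b := exp (2 * (a₀ + 1)) / 2)
      (by gcongr) (by gcongr; linarith)
    rw [log_div (exp_pos _).ne' two_ne_zero, log_div (exp_pos _).ne' two_ne_zero, log_exp,
      log_exp, show 2 * a - log 2 - (2 * a₀ - log 2) = 2 * (a - a₀) by ring] at this
    exact this
  have hT : Tendsto (fun a => √((2 * (a - a₀)) ^ 2 * K)) (nhds a₀) (nhds 0) := by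
    have : Continuous fun a : ℝ => √((2 * (a - a₀)) ^ 2 * K) := by fun_prop
    simpa using this.tendsto a₀
  have hev : ∀ᶠ a in nhds a₀, a < a₀ + 1 := gt_mem_nhds (by linarith)
  constructor
  · rw [tendsto_iff_dist_tendsto_zero]
    refine squeeze_zero' (Eventually.of_forall fun _ => dist_nonneg) ?_ hT
    filter_upwards [hev] with a ha
    rw [Real.dist_eq]
    exact abs_le_sqrt (by linarith [hK a ha, sq_nonneg (log (P a x) - log (P a₀ x))])
  · have hpos : ∀ a, 0 < P a x := fun a => (h a).pos x ⟨hx.1.le, hx.2⟩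
    have hlog : Tendsto (fun a => log (P a x)) (nhds a₀) (nhds (log (P a₀ x))) := by
      rw [tendsto_iff_dist_tendsto_zero]
      refine squeeze_zero' (Eventually.of_forall fun _ => dist_nonneg) ?_ hT
      filter_upwards [hev] with a ha
      rw [Real.dist_eq]
      exact abs_le_sqrt (by linarith [hK a ha, sq_nonneg (M a x - M a₀ x)])
    have := (continuous_exp.tendsto _).comp hlog
    rw [exp_log (hpos a₀)] at this
    exact this.congr fun a => exp_log (hpos a)

theorem continuous_total (hN : 0 ≤ N)
    (h : ∀ a, IsProfile N (exp (2 * a) / 2) (α a) (M a) (P a)) : Continuous α := by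
  refine continuous_iff_continuousAt.2 fun a₀ => tendsto_order.2 ⟨fun l hl => ?_, fun l hl => ?_⟩
  · obtain ⟨x, hx1, hx⟩ := (((h a₀).lim.eventually (lt_mem_nhds hl)).and
      (Ioo_mem_nhdsLT zero_lt_one)).exists
    filter_upwards [(tendsto_of_family hN h a₀ hx).1.eventually (lt_mem_nhds hx1)] with a ha
    exact ha.trans ((h a).lt_total ⟨hx.1.le, hx.2⟩)
  · have h0 := (h a₀).add_one_lt_total hN
    set c := (α a₀ - (N + 1)) / 2 with hc
    have hcpos : 0 < c := by linarith
    have hcl : 0 < c * (l - α a₀) := mul_pos hcpos (by linarith)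
    obtain ⟨x, ⟨hx1, hx2⟩, hx⟩ := ((((h a₀).lim.eventually
      (lt_mem_nhds (by linarith : N + 1 + c < α a₀))).and
      (((h a₀).tendsto_flux hN).eventually (gt_mem_nhds hcl))).and
      (Ioo_mem_nhdsLT zero_lt_one)).exists
    obtain ⟨hM, hP⟩ := tendsto_of_family hN h a₀ hx
    filter_upwards [hM.eventually (lt_mem_nhds hx1),
      (hP.const_mul (2 * x * (1 - x))).eventually (gt_mem_nhds hx2),
      hM.eventually (gt_mem_nhds ((h a₀).lt_total ⟨hx.1.le, hx.2⟩))] with a h1 h2 h3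
    have h4 := (h a).tail_le_flux hN hx
    have h5 := (h a).lt_total ⟨hx.1.le, hx.2⟩
    have h6 : (α a - M a x) * c ≤ (α a - M a x) * (α a + M a x - 2 - 2 * N) :=
      mul_le_mul_of_nonneg_left (by linarith) (by linarith)
    have h7 : c * (α a - M a x) < c * (l - α a₀) := by linarith
    linarith [lt_of_mul_lt_mul_left h7 hcpos.le]

theorem eventually_lt_total (hN : 0 < N)
    (h : ∀ a, IsProfile N (exp (2 * a) / 2) (α a) (M a) (P a)) {c : ℝ} (hc : c < 2 * N) :
    (∀ᶠ a in atBot, c < α a) ∧ ∀ᶠ a in atTop, c < α a := by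
  obtain ⟨q₁, q₂, hq, hlt⟩ := IsProfile.exists_lt_total hN hc
  have hlin : Tendsto (fun a : ℝ => 2 * a) atBot atBot := tendsto_id.const_mul_atBot two_pos
  have hlin' : Tendsto (fun a : ℝ => 2 * a) atTop atTop := tendsto_id.const_mul_atTop two_pos
  constructor
  · filter_upwards [(tendsto_exp_atBot.comp hlin).eventually (gt_mem_nhds (by positivity :
      0 < 2 * q₁))] with a ha
    simp only [Function.comp] at ha
    exact hlt _ _ _ _ (Or.inl (by linarith)) (h a)
  · filter_upwards [(tendsto_exp_atTop.comp hlin').eventually_gt_atTop (2 * q₂)] with a ha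
    simp only [Function.comp] at ha
    exact hlt _ _ _ _ (Or.inr (by linarith)) (h a)

theorem exists_total_lt (hN : 2 ≤ N)
    (h : ∀ a, IsProfile N (exp (2 * a) / 2) (α a) (M a) (P a)) : ∃ b, α b < 2 * N := by
  have hinit : ∀ q : ℝ, 0 < q → exp (2 * (log (2 * q) / 2)) / 2 = q := by
    intro q hq
    rw [mul_div_cancel₀ _ (two_ne_zero), exp_log (by positivity)]
    ring
  rcases hN.eq_or_lt with rfl | hlt
  · refine ⟨log (2 * 5) / 2, ?_⟩
    have := h (log (2 * 5) / 2)
    rw [hinit 5 (by norm_num)] at this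
    linarith [this.total_lt_four (by norm_num)]
  · refine ⟨log (2 * (N + 2)) / 2, ?_⟩
    have := h (log (2 * (N + 2)) / 2)
    rw [hinit (N + 2) (by linarith)] at this
    linarith [this.total_eq_of_linear (by linarith)]

end Family

theorem tendsto_sqrt_div_one_sub :
    Tendsto (fun x : ℝ => √(x / (1 - x))) (nhdsWithin 1 (Iio 1)) atTop := by
  refine tendsto_sqrt_atTop.comp ?_
  have h1 : Tendsto (fun x : ℝ => 1 - x) (nhdsWithin 1 (Iio 1)) (nhdsWithin 0 (Ioi 0)) := by
    refine tendsto_nhdsWithin_iff.2 ⟨?_, ?_⟩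
    · have : Continuous fun y : ℝ => 1 - y := by fun_prop
      simpa using (this.tendsto 1).mono_left nhdsWithin_le_nhds
    · filter_upwards [self_mem_nhdsWithin] with y hy
      simpa using hy
  have h2 : Tendsto (fun x : ℝ => x) (nhdsWithin 1 (Iio 1)) (nhds 1) :=
    tendsto_id.mono_left nhdsWithin_le_nhds
  exact h2.pos_mul_atTop one_pos (tendsto_inv_nhdsGT_zero.comp h1)

theorem hasDerivAt_sqrt_div_one_sub {x : ℝ} (hx : x ∈ Ioo (0:ℝ) 1) :
    HasDerivAt (fun x : ℝ => √(x / (1 - x))) (1 / (2 * √(x / (1 - x)) * (1 - x) ^ 2)) x := by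
  have hx1 : 0 < 1 - x := by linarith [hx.2]
  have hpos : 0 < x / (1 - x) := div_pos hx.1 hx1
  have hr : 0 < √(x / (1 - x)) := sqrt_pos.2 hpos
  refine (((hasDerivAt_id x).div ((hasDerivAt_id x).const_sub 1) hx1.ne').sqrt
    hpos.ne').congr_deriv ?_
  simp
  field_simp

namespace IsSol

variable {N : ℝ} {u : ℝ → ℝ}

theorem hasDerivAt (h : IsSol N u) {r : ℝ} (hr : 0 < r) :
    HasDerivAt u (derivWithin u (Ici 0) r) r := by
  rw [derivWithin_of_mem_nhds (Ici_mem_nhds hr)]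
  exact ((h.1.contDiffAt (Ici_mem_nhds hr)).differentiableAt (by norm_num)).hasDerivAt

theorem continuousOn_derivWithin (h : IsSol N u) :
    ContinuousOn (derivWithin u (Ici 0)) (Ici 0) :=
  h.1.continuousOn_derivWithin (uniqueDiffOn_Ici 0) (by norm_num)

/-- Divergence form of the equation. -/
theorem hasDerivAt_mul_derivWithin (h : IsSol N u) {r : ℝ} (hr : 0 < r) :
    HasDerivAt (fun s => -(s * derivWithin u (Ici 0) s))
      ((1 + r ^ 2) ^ N * exp (2 * u r) * r) r := by
  have heq : derivWithin u (Ici 0) =ᶠ[nhds r] deriv u := by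
    filter_upwards [Ioi_mem_nhds hr] with s hs
    exact derivWithin_of_mem_nhds (Ici_mem_nhds hs)
  have hd : HasDerivAt (deriv u) (deriv (deriv u) r) r := by
    exact (((h.1.contDiffAt (Ici_mem_nhds hr)).derivWithin (m := 1)
      one_add_one_eq_two.le).differentiableAt one_ne_zero).hasDerivAt
  refine ((hasDerivAt_id r).mul (hd.congr_of_eventuallyEq heq)).neg.congr_deriv ?_
  have h1 := h.2.1 r hr
  rw [heq.eq_of_nhds]
  simp only [id]
  field_simp at h1
  linarith

theorem tendsto_mass (h : IsSol N u) :
    Tendsto (fun r => -(r * derivWithin u (Ici 0) r)) atTop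
      (nhds (∫ r in Ioi (0:ℝ), (1 + r ^ 2) ^ N * exp (2 * u r) * r)) := by
  refine (intervalIntegral_tendsto_integral_Ioi 0 h.2.2.2 tendsto_id).congr' ?_
  filter_upwards [eventually_gt_atTop 0] with R hR
  have := intervalIntegral.integral_eq_sub_of_hasDerivAt_of_le hR.le
    (f := fun s => -(s * derivWithin u (Ici 0) s))
    ((continuousOn_id.mul (h.continuousOn_derivWithin.mono Icc_subset_Ici_self)).neg)
    (fun r hr => h.hasDerivAt_mul_derivWithin hr.1)
    ((intervalIntegrable_iff_integrableOn_Ioc_of_le hR.le).2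
      (h.2.2.2.mono_set Ioc_subset_Ioi_self))
  simpa using this

theorem isProfile (h : IsSol N u) :
    IsProfile N (exp (2 * u 0) / 2) (∫ r in Ioi (0:ℝ), (1 + r ^ 2) ^ N * exp (2 * u r) * r)
      (fun x => -(√(x / (1 - x)) * derivWithin u (Ici 0) √(x / (1 - x))))
      (fun x => (1 - x) ^ (-(N + 2)) * exp (2 * u √(x / (1 - x))) / 2) := by
  have hcr : ContinuousOn (fun x : ℝ => √(x / (1 - x))) (Ico 0 1) :=
    (continuousOn_id.div (by fun_prop) fun x hx => by
      linarith [hx.2]).sqrt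
  have hmaps : MapsTo (fun x : ℝ => √(x / (1 - x))) (Ico 0 1) (Ici 0) :=
    fun x _ => sqrt_nonneg _
  have hr : ∀ x ∈ Ioo (0:ℝ) 1, 0 < √(x / (1 - x)) := fun x hx =>
    sqrt_pos.2 (div_pos hx.1 (by linarith [hx.2]))
  have hsq : ∀ x ∈ Ioo (0:ℝ) 1, √(x / (1 - x)) ^ 2 = x / (1 - x) := fun x hx =>
    sq_sqrt (div_pos hx.1 (by linarith [hx.2])).le
  refine ⟨fun x hx => ?_, fun x hx => ?_, fun x hx => ?_, ?_, ?_, ?_, ?_, ?_⟩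
  · have hx1 : 0 < 1 - x := by linarith [hx.2]
    refine ((h.hasDerivAt_mul_derivWithin (hr x hx)).comp x
      (hasDerivAt_sqrt_div_one_sub hx)).congr_deriv ?_
    have h1 : 1 + √(x / (1 - x)) ^ 2 = (1 - x)⁻¹ := by
      rw [hsq x hx]; field_simp; ring
    have h2 : (1 - x) ^ (-(N + 2)) = ((1 - x)⁻¹) ^ N / (1 - x) ^ 2 := by
      rw [inv_rpow hx1.le, ← rpow_neg hx1.le, neg_add, ← sub_eq_add_neg, rpow_sub hx1]
      norm_num
    rw [h1, h2]
    have := (hr x hx).ne'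
    field_simp
  · have hx1 : 0 < 1 - x := by linarith [hx.2]
    have hd := ((h.hasDerivAt (hr x hx)).comp x (hasDerivAt_sqrt_div_one_sub hx)).const_mul 2
    have hp := ((hasDerivAt_id x).const_sub 1).rpow_const (p := -(N + 2)) (Or.inl hx1.ne')
    refine ((hp.mul hd.exp).div_const 2).congr_deriv ?_
    have h1 := (hr x hx).ne'
    have h2 := hsq x hx
    have h3 := hx.1.ne'
    simp only [id, Function.comp]
    rw [rpow_sub_one hx1.ne']
    set r := √(x / (1 - x))
    have h4 : x = r ^ 2 * (1 - x) := by rw [h2]; field_simp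
    have h5 : 1 / (2 * r * (1 - x) ^ 2) = r / (2 * x * (1 - x)) := by
      rw [div_eq_div_iff (by positivity) (by positivity)]
      linear_combination (2 * (1 - x)) * h4
    rw [h5]
    field_simp
    ring
  · have : 0 < 1 - x := by linarith [hx.2]
    positivity
  · exact (hcr.mul (h.continuousOn_derivWithin.comp hcr hmaps)).neg
  · have h1 : ContinuousOn (fun x : ℝ => (1 - x) ^ (-(N + 2))) (Ico 0 1) :=
      ContinuousOn.rpow_const (by fun_prop) fun x hx => Or.inl (by linarith [hx.2])
    have h2 := h.1.continuousOn.comp hcr hmaps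
    exact (h1.mul (h2.const_smul (2:ℝ)).rexp).div_const 2
  · simp
  · simp
  · exact h.tendsto_mass.comp tendsto_sqrt_div_one_sub

end IsSol

/-- For `N ≥ 2`, the infimum `α_N = inf_a α(a)` is attained and `α_N < 2N`; for every
`α₀ ∈ (α_N, 2N)` the value `α₀` is attained at two distinct parameters, i.e. there are
at least two distinct radial solutions at level `α₀`. -/
theorem multiplicity_below_2N (N : ℝ) (hN : 2 ≤ N)
    (u : ℝ → ℝ → ℝ) (hu : ∀ a : ℝ, IsSol N (u a) ∧ u a 0 = a)
    (α : ℝ → ℝ)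
    (hα : ∀ a : ℝ, α a = ∫ r in Ioi (0:ℝ), (1 + r ^ 2) ^ N * Real.exp (2 * u a r) * r) :
    ∃ amin : ℝ, (∀ a : ℝ, α amin ≤ α a) ∧ α amin < 2 * N ∧
      ∀ α₀ ∈ Ioo (α amin) (2 * N),
        (∃ a₁ a₂ : ℝ, a₁ ≠ a₂ ∧ α a₁ = α₀ ∧ α a₂ = α₀) ∧
        (∃ v w : ℝ → ℝ, IsSolAtLevel N α₀ v ∧ IsSolAtLevel N α₀ w ∧
          ¬ EqOn v w (Ici 0)) := by
  have hN0 : 0 < N := by linarith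
  have hprof : ∀ a, IsProfile N (exp (2 * a) / 2) (α a) _ _ := fun a => by
    simpa only [(hu a).2, ← hα a] using (hu a).1.isProfile
  have hcont : Continuous α := continuous_total hN0.le hprof
  obtain ⟨b, hb⟩ := exists_total_lt hN hprof
  obtain ⟨amin, hmin⟩ := hcont.exists_forall_le' b (by
    rw [cocompact_eq_atBot_atTop]
    obtain ⟨h1, h2⟩ := eventually_lt_total hN0 hprof hb
    exact eventually_sup.2 ⟨h1.mono fun _ h => h.le, h2.mono fun _ h => h.le⟩)
  refine ⟨amin, hmin, (hmin b).trans_lt hb, fun α₀ hα₀ => ?_⟩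
  obtain ⟨h1, h2⟩ := eventually_lt_total hN0 hprof hα₀.2
  obtain ⟨s, hs, hsm⟩ := (h1.and (eventually_lt_atBot amin)).exists
  obtain ⟨t, ht, htm⟩ := (h2.and (eventually_gt_atTop amin)).exists
  obtain ⟨a₁, ha₁, he₁⟩ := intermediate_value_Ioo' hsm.le hcont.continuousOn ⟨hα₀.1, hs⟩
  obtain ⟨a₂, ha₂, he₂⟩ := intermediate_value_Ioo htm.le hcont.continuousOn ⟨hα₀.1, ht⟩
  have hne : a₁ ≠ a₂ := (ha₁.2.trans ha₂.1).ne
  have hlevel : ∀ a, α a = α₀ → IsSolAtLevel N α₀ (u a) := fun a ha =>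
    ⟨(hu a).1.1, (hu a).1.2.1, (hu a).1.2.2.1, (hu a).1.2.2.2, (hα a).symm.trans ha⟩
  refine ⟨⟨a₁, a₂, hne, he₁, he₂⟩, u a₁, u a₂, hlevel a₁ he₁, hlevel a₂ he₂, fun heq => hne ?_⟩
  have := heq (mem_Ici.2 le_rfl)
  rwa [(hu a₁).2, (hu a₂).2] at this
end
end

section
/- Let N ≥ 1 and let a₁ < a₂ be real numbers such that α'(a₁) = α'(a₂) = 0 and α'(a) ≠ 0 for all a ∈ (a₁, a₂). Then for all a, b ∈ (a₁, a₂), the functions φ_a and φ_b have the same finite number of zeroes in (0,∞). -/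
open Real Set MeasureTheory Filter

noncomputable section

/-- `φ` solves the linearized equation `φ'' + φ'/r + 2(1+r²)^N e^{2u} φ = 0` on `(0,∞)`,
is `C²` on `[0,∞)`, with `φ(0) = 1` and `φ'(0) = 0`. -/
def IsLin (N : ℝ) (u φ : ℝ → ℝ) : Prop :=
  ContDiffOn ℝ 2 φ (Ici 0) ∧
  (∀ r : ℝ, 0 < r →
    deriv (deriv φ) r + deriv φ r / r
      + 2 * (1 + r ^ 2) ^ N * Real.exp (2 * u r) * φ r = 0) ∧
  φ 0 = 1 ∧ derivWithin φ (Ici 0) 0 = 0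

section

open Topology

/-- A radial function `w`, with derivative `p`, solving `w'' + w'/r = g` on `(0,∞)`, of class `C¹` up to the
origin with `w'(0) = 0`. -/
structure IsRadial (w p g : ℝ → ℝ) : Prop where
  cont : ContinuousOn w (Ici 0)
  cont_deriv : ContinuousOn p (Ici 0)
  deriv_zero : p 0 = 0
  hasDerivAt : ∀ r, 0 < r → HasDerivAt w (p r) r
  hasDerivAt_deriv : ∀ r, 0 < r → HasDerivAt p (g r - p r / r) r

theorem isRadial_of_contDiffOn {w g : ℝ → ℝ} (hw : ContDiffOn ℝ 2 w (Ici 0))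
    (h0 : derivWithin w (Ici 0) 0 = 0)
    (hg : ∀ r, 0 < r → deriv (deriv w) r + deriv w r / r = g r) :
    IsRadial w (derivWithin w (Ici 0)) g := by
  have h1 : ContDiffOn ℝ 1 (derivWithin w (Ici 0)) (Ici 0) :=
    hw.derivWithin (uniqueDiffOn_Ici 0) (by norm_num)
  have heq : ∀ r, 0 < r → derivWithin w (Ici 0) r = deriv w r := fun r hr =>
    derivWithin_of_mem_nhds (Ici_mem_nhds hr)
  refine ⟨hw.continuousOn, h1.continuousOn, h0, fun r hr => ?_, fun r hr => ?_⟩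
  · rw [heq r hr]
    exact ((hw.differentiableOn (by norm_num)).differentiableAt (Ici_mem_nhds hr)).hasDerivAt
  · have h2 := ((h1.differentiableOn (by norm_num)).differentiableAt (Ici_mem_nhds hr)).hasDerivAt
    have h3 : deriv (derivWithin w (Ici 0)) r = deriv (deriv w) r := by
      apply Filter.EventuallyEq.deriv_eq
      filter_upwards [Ioi_mem_nhds hr] with s hs using heq s hs
    rw [h3] at h2
    have : g r - derivWithin w (Ici 0) r / r = deriv (deriv w) r := by
      rw [heq r hr, ← hg r hr]; ring
    rwa [this]

namespace IsRadial

variable {w p g w₁ p₁ g₁ w₂ p₂ g₂ : ℝ → ℝ}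

theorem sub (h₁ : IsRadial w₁ p₁ g₁) (h₂ : IsRadial w₂ p₂ g₂) :
    IsRadial (fun r => w₁ r - w₂ r) (fun r => p₁ r - p₂ r) (fun r => g₁ r - g₂ r) where
  cont := h₁.cont.sub h₂.cont
  cont_deriv := h₁.cont_deriv.sub h₂.cont_deriv
  deriv_zero := by simp [h₁.deriv_zero, h₂.deriv_zero]
  hasDerivAt r hr := (h₁.hasDerivAt r hr).sub (h₂.hasDerivAt r hr)
  hasDerivAt_deriv r hr := by
    refine ((h₁.hasDerivAt_deriv r hr).sub (h₂.hasDerivAt_deriv r hr)).congr_deriv ?_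
    ring

theorem const_mul (c : ℝ) (h : IsRadial w p g) :
    IsRadial (fun r => c * w r) (fun r => c * p r) (fun r => c * g r) where
  cont := h.cont.const_smul c
  cont_deriv := h.cont_deriv.const_smul c
  deriv_zero := by simp [h.deriv_zero]
  hasDerivAt r hr := (h.hasDerivAt r hr).const_mul c
  hasDerivAt_deriv r hr := by
    refine ((h.hasDerivAt_deriv r hr).const_mul c).congr_deriv ?_
    ring

theorem hasDerivAt_mul_deriv (h : IsRadial w p g) {r : ℝ} (hr : 0 < r) :
    HasDerivAt (fun s => s * p s) (r * g r) r := by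
  refine ((hasDerivAt_id' r).mul (h.hasDerivAt_deriv r hr)).congr_deriv ?_
  field_simp
  ring

theorem continuousOn_mul_deriv (h : IsRadial w p g) :
    ContinuousOn (fun s => s * p s) (Ici 0) :=
  continuousOn_id.mul h.cont_deriv

/-- Grönwall estimate for radial functions. -/
theorem abs_le_of_abs_le (h : IsRadial w p g) {R A B : ℝ} (hA : 0 ≤ A) (hB : 0 ≤ B)
    (hg : ∀ r, 0 < r → r < R → |g r| ≤ A * |w r| + B) {r : ℝ} (hr : 0 ≤ r) (hrR : r ≤ R) :
    |w r| ≤ (|w 0| + B) * exp ((A + 2) * R) ∧ |p r| ≤ (|w 0| + B) * exp ((A + 2) * R) := by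
  have hsub : Icc 0 R ⊆ Ici (0 : ℝ) := fun x hx => hx.1
  have hanti : AntitoneOn (fun s => (w s ^ 2 + p s ^ 2 + B ^ 2) * exp (-((A + 2) * s)))
      (Icc 0 R) := by
    refine antitoneOn_of_hasDerivWithinAt_nonpos (f' := fun s =>
      (2 * w s * p s + 2 * p s * (g s - p s / s)) * exp (-((A + 2) * s))
        + (w s ^ 2 + p s ^ 2 + B ^ 2) * (exp (-((A + 2) * s)) * (-(A + 2))))
      (convex_Icc 0 R) ?_ ?_ ?_
    · have := h.cont.mono hsub
      have := h.cont_deriv.mono hsub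
      fun_prop
    · intro s hs
      rw [interior_Icc] at hs
      have h1 := h.hasDerivAt s hs.1
      have h2 := h.hasDerivAt_deriv s hs.1
      have h3 : HasDerivAt (fun s => exp (-((A + 2) * s))) (exp (-((A + 2) * s)) * (-(A + 2))) s := by
        simpa using (((hasDerivAt_id' s).const_mul (A + 2)).neg).exp
      refine (((((h1.pow 2).add (h2.pow 2)).add_const (B ^ 2)).mul h3).congr_deriv ?_).hasDerivWithinAt
      simp
    · intro s hs
      rw [interior_Icc] at hs
      have hE := exp_pos (-((A + 2) * s))
      have hgs := hg s hs.1 hs.2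
      have hps : 0 ≤ p s * (p s / s) := by
        rw [mul_div_assoc']; exact div_nonneg (mul_self_nonneg _) hs.1.le
      have hpg : p s * g s ≤ |p s| * (A * |w s| + B) :=
        (le_abs_self _).trans (by rw [abs_mul]; gcongr)
      have hwp : w s * p s ≤ |w s| * |p s| := (le_abs_self _).trans (abs_mul _ _).le
      have key : 2 * w s * p s + 2 * p s * (g s - p s / s)
          - (A + 2) * (w s ^ 2 + p s ^ 2 + B ^ 2) ≤ 0 := by
        rw [← sq_abs (w s), ← sq_abs (p s)]
        nlinarith [mul_nonneg hA (sq_nonneg (|w s| - |p s|)), sq_nonneg (|w s| - |p s|),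
          sq_nonneg (|p s| - B), mul_nonneg hA (sq_nonneg B), sq_nonneg (|w s|), sq_nonneg B]
      nlinarith
  have hmono := hanti (left_mem_Icc.2 (hr.trans hrR)) ⟨hr, hrR⟩ hr
  simp only [h.deriv_zero, mul_zero, neg_zero, exp_zero, mul_one] at hmono
  have hE : w r ^ 2 + p r ^ 2 + B ^ 2 ≤ (w 0 ^ 2 + B ^ 2) * exp ((A + 2) * r) := by
    rw [exp_neg, ← div_eq_mul_inv, div_le_iff₀ (exp_pos _)] at hmono
    simpa using hmono
  have hT : exp ((A + 2) * r) ≤ exp ((A + 2) * R) := by gcongr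
  have hT1 : 1 ≤ exp ((A + 2) * R) := one_le_exp (by nlinarith)
  have hfin : w r ^ 2 + p r ^ 2 ≤ ((|w 0| + B) * exp ((A + 2) * R)) ^ 2 := by
    set T := exp ((A + 2) * R)
    calc w r ^ 2 + p r ^ 2 ≤ (w 0 ^ 2 + B ^ 2) * exp ((A + 2) * r) := by nlinarith [sq_nonneg B]
      _ ≤ (w 0 ^ 2 + B ^ 2) * T := by gcongr
      _ ≤ (|w 0| + B) ^ 2 * T ^ 2 := by
        gcongr
        · rw [← sq_abs (w 0)]; nlinarith [mul_nonneg (abs_nonneg (w 0)) hB]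
        · nlinarith
      _ = _ := by ring
  have hpos : 0 ≤ (|w 0| + B) * exp ((A + 2) * R) := by positivity
  constructor <;> apply abs_le_of_sq_le_sq _ hpos <;> nlinarith [sq_nonneg (w r), sq_nonneg (p r)]

/-- A radial solution of a linear equation vanishing to first order at a point `z > 0`
vanishes on `[0, z]`. -/
theorem eq_zero_of_deriv_eq_zero (h : IsRadial w p g) {z A : ℝ} (hz : 0 < z) (hA : 0 ≤ A)
    (hg : ∀ r, 0 < r → r < z → |g r| ≤ A * |w r|) (hw : w z = 0) (hp : p z = 0) : w 0 = 0 := by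
  have hpos : ∀ s ∈ Ioo 0 z, w s = 0 := by
    intro s hs
    have hsub : Icc s z ⊆ Ici (0 : ℝ) := fun x hx => hs.1.le.trans hx.1
    set c := A + 1 + 2 / s with hc
    have hmono : MonotoneOn (fun t => (w t ^ 2 + p t ^ 2) * exp (c * t)) (Icc s z) := by
      refine monotoneOn_of_hasDerivWithinAt_nonneg (f' := fun t =>
        (2 * w t * p t + 2 * p t * (g t - p t / t)) * exp (c * t)
          + (w t ^ 2 + p t ^ 2) * (exp (c * t) * c)) (convex_Icc s z) ?_ ?_ ?_
      · have := h.cont.mono hsub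
        have := h.cont_deriv.mono hsub
        fun_prop
      · intro t ht
        rw [interior_Icc] at ht
        have ht0 := hs.1.trans ht.1
        have h1 := h.hasDerivAt t ht0
        have h2 := h.hasDerivAt_deriv t ht0
        have h3 : HasDerivAt (fun t => exp (c * t)) (exp (c * t) * c) t := by
          simpa using ((hasDerivAt_id' t).const_mul c).exp
        refine ((((h1.pow 2).add (h2.pow 2)).mul h3).congr_deriv ?_).hasDerivWithinAt
        simp
      · intro t ht
        rw [interior_Icc] at ht
        have ht0 := hs.1.trans ht.1
        have hE := exp_pos (c * t)
        have hps : p t * (p t / t) ≤ p t ^ 2 * (1 / s) := by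
          have : 1 / t ≤ 1 / s := one_div_le_one_div_of_le hs.1 ht.1.le
          calc p t * (p t / t) = p t ^ 2 * (1 / t) := by ring
            _ ≤ _ := by gcongr
        have hpg : -(p t * g t) ≤ |p t| * (A * |w t|) :=
          (neg_le_abs _).trans (by rw [abs_mul]; gcongr; exact hg t ht0 ht.2)
        have hwp : -(w t * p t) ≤ |w t| * |p t| := (neg_le_abs _).trans (abs_mul _ _).le
        have hs2 : 2 / s = 2 * (1 / s) := by ring
        have hs3 : 0 < 1 / s := by have := hs.1; positivity
        have key : 0 ≤ 2 * w t * p t + 2 * p t * (g t - p t / t)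
            + c * (w t ^ 2 + p t ^ 2) := by
          rw [hc, hs2]
          have e1 := sq_abs (w t)
          have e2 := sq_abs (p t)
          nlinarith [mul_nonneg hA (sq_nonneg (|w t| - |p t|)), sq_nonneg (|w t| - |p t|),
            mul_nonneg hs3.le (sq_nonneg (w t))]
        nlinarith
    have hm := hmono (left_mem_Icc.2 hs.2.le) (right_mem_Icc.2 hs.2.le) hs.2.le
    simp only [hw, hp] at hm
    have : w s ^ 2 + p s ^ 2 ≤ 0 := by
      have hE := exp_pos (c * s)
      by_contra! hcon
      have := mul_pos hcon hE
      norm_num at hm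
      linarith
    nlinarith [sq_nonneg (w s), sq_nonneg (p s)]
  have hlim : Tendsto w (𝓝[Ioi 0] 0) (𝓝 (w 0)) :=
    (h.cont 0 self_mem_Ici).mono Ioi_subset_Ici_self
  refine tendsto_nhds_unique hlim (tendsto_const_nhds.congr' ?_)
  filter_upwards [Ioo_mem_nhdsGT hz] with s hs using (hpos s hs).symm

/-- Behaviour at infinity of radial solutions of an equation with decaying coefficient. -/
theorem abs_mul_deriv_sub_le (h : IsRadial w p g) {R₀ C ε : ℝ} (hR₀ : 1 ≤ R₀) (hC : 0 ≤ C)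
    (hε : 0 < ε) (hg : ∀ r, R₀ ≤ r → |r * g r| ≤ C * (r ^ (-ε)) ^ 2 / r * |w r|)
    {R r : ℝ} (hR : R₀ ≤ R) (hr : R ≤ r) :
    |r * p r - R * p R| ≤
      C * (|w R₀| + |R₀ * p R₀|) * exp ((1 + C) / ε) / ε * R ^ (-ε) := by
  have hqd : ∀ s, 0 < s → HasDerivAt (fun t : ℝ => t ^ (-ε)) (-ε * s ^ (-ε) / s) s := by
    intro s hs
    convert Real.hasDerivAt_rpow_const (p := -ε) (Or.inl hs.ne') using 1
    rw [rpow_sub_one hs.ne']; ring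
  have hqp : ∀ s : ℝ, 0 < s → 0 < s ^ (-ε) := fun s hs => rpow_pos_of_pos hs _
  have hq1 : ∀ s : ℝ, 1 ≤ s → s ^ (-ε) ≤ 1 := fun s hs =>
    rpow_le_one_of_one_le_of_nonpos hs (by linarith)
  have hq0 : ∀ s, R₀ ≤ s → 0 < s := fun s hs => by linarith
  have hqc : ContinuousOn (fun t : ℝ => t ^ (-ε)) (Ici R₀) := fun s hs =>
    (hqd s (hq0 s hs)).continuousAt.continuousWithinAt
  generalize hq : (fun t : ℝ => t ^ (-ε)) = q at *
  have hq' : ∀ t : ℝ, t ^ (-ε) = q t := fun t => congrFun hq t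
  simp only [hq'] at *
  have hsub : Ici R₀ ⊆ Ici (0 : ℝ) := fun x hx => (hq0 x hx).le
  have hwc := h.cont.mono hsub
  have hyc := h.continuousOn_mul_deriv.mono hsub
  set y := fun s => s * p s with hy
  have hyd : ∀ s, 0 < s → HasDerivAt y (s * g s) s := fun s hs => h.hasDerivAt_mul_deriv hs
  have hwd : ∀ s, 0 < s → HasDerivAt w (y s / s) s := fun s hs => by
    convert h.hasDerivAt s hs using 1
    simp only [hy]; field_simp
  set S := (|w R₀| + |R₀ * p R₀|) * exp ((1 + C) / ε) with hS
  have hS0 : 0 ≤ S := by positivity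
  have hbound : ∀ s, R₀ ≤ s → |q s * w s| ≤ S := by
    have hanti : AntitoneOn (fun s => ((q s * w s) ^ 2 + y s ^ 2) * exp ((1 + C) / ε * q s))
        (Ici R₀) := by
      refine antitoneOn_of_hasDerivWithinAt_nonpos (f' := fun s =>
        (2 * (q s * w s) * (-ε * q s / s * w s + q s * (y s / s)) + 2 * y s * (s * g s))
          * exp ((1 + C) / ε * q s) + ((q s * w s) ^ 2 + y s ^ 2) *
          (exp ((1 + C) / ε * q s) * ((1 + C) / ε * (-ε * q s / s)))) (convex_Ici R₀) ?_ ?_ ?_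
      · fun_prop
      · intro s hs
        rw [interior_Ici] at hs
        have hs0 := hq0 s hs.le
        have h3 := ((hqd s hs0).const_mul ((1 + C) / ε)).exp
        refine ((((((hqd s hs0).mul (hwd s hs0)).pow 2).add ((hyd s hs0).pow 2)).mul
          h3).congr_deriv ?_).hasDerivWithinAt
        simp
      · intro s hs
        rw [interior_Ici] at hs
        have hs0 := hq0 s hs.le
        have hgs := hg s hs.le
        have hqs := hqp s hs0
        have hE := exp_pos ((1 + C) / ε * q s)
        have hi : 0 < 1 / s := by positivity
        have e1 : (1 + C) / ε * (-ε * q s / s) = -((1 + C) * q s * (1 / s)) := by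
          field_simp
        have e2 : C * q s ^ 2 / s * |w s| = C * q s * (1 / s) * |q s * w s| := by
          rw [abs_mul, abs_of_pos hqs]; ring
        have e3 : 2 * (q s * w s) * (-ε * q s / s * w s + q s * (y s / s))
          = -(2 * ε * (1 / s) * (q s * w s) ^ 2) + 2 * (q s * (1 / s)) * ((q s * w s) * y s) := by
          ring
        rw [e2] at hgs
        rw [e1, e3]
        set X := q s * w s
        set i := 1 / s
        have h1 : y s * (s * g s) ≤ |y s| * (C * q s * i * |X|) :=
          (le_abs_self _).trans (by rw [abs_mul]; gcongr)
        have h2 : X * y s ≤ |X| * |y s| := (le_abs_self _).trans (abs_mul _ _).le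
        have hqi : 0 < q s * i := mul_pos hqs hi
        have h4 : 0 ≤ ε * i * X ^ 2 := by positivity
        have h5 : (q s * i) * (X * y s) ≤ (q s * i) * (|X| * |y s|) := by gcongr
        have h6 : 0 ≤ (1 + C) * (q s * i) * (|X| - |y s|) ^ 2 := by positivity
        have key : -(2 * ε * i * X ^ 2) + 2 * (q s * i) * (X * y s) + 2 * y s * (s * g s)
            - (X ^ 2 + y s ^ 2) * ((1 + C) * q s * i) ≤ 0 := by
          rw [← sq_abs X, ← sq_abs (y s)]
          rw [← sq_abs X] at h4
          nlinarith
        nlinarith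
    intro s hs
    have hm := hanti self_mem_Ici hs hs
    have hs0 := hq0 s hs
    simp only at hm
    have hE1 : 1 ≤ exp ((1 + C) / ε * q s) := one_le_exp (by have := hqp s hs0; positivity)
    have hE2 : exp ((1 + C) / ε * q R₀) ≤ exp ((1 + C) / ε) := by
      apply exp_le_exp.2
      have := hq1 R₀ hR₀
      have h0 : 0 ≤ (1 + C) / ε := by positivity
      nlinarith
    have hE3 : 1 ≤ exp ((1 + C) / ε) := one_le_exp (by positivity)
    apply abs_le_of_sq_le_sq _ hS0
    calc (q s * w s) ^ 2 ≤ ((q s * w s) ^ 2 + y s ^ 2) * 1 := by nlinarith [sq_nonneg (y s)]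
      _ ≤ ((q s * w s) ^ 2 + y s ^ 2) * exp ((1 + C) / ε * q s) := by gcongr
      _ ≤ _ := hm
      _ ≤ (|w R₀| + |R₀ * p R₀|) ^ 2 * exp ((1 + C) / ε) ^ 2 := by
        gcongr
        · have e : (q R₀ * w R₀) ^ 2 ≤ |w R₀| ^ 2 := by
            rw [mul_pow, sq_abs]
            have := hq1 R₀ hR₀
            have := hqp R₀ (by linarith)
            have : q R₀ ^ 2 ≤ 1 := by nlinarith
            nlinarith [sq_nonneg (w R₀)]
          have e2 : y R₀ ^ 2 = |R₀ * p R₀| ^ 2 := by rw [sq_abs]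
          nlinarith [mul_nonneg (abs_nonneg (w R₀)) (abs_nonneg (R₀ * p R₀))]
        · nlinarith
      _ = S ^ 2 := by rw [hS]; ring
  have hder : ∀ s, R₀ ≤ s → |s * g s| ≤ C * S * (q s / s) := by
    intro s hs
    have hs0 := hq0 s hs
    have hqs := hqp s hs0
    calc |s * g s| ≤ C * q s ^ 2 / s * |w s| := hg s hs
      _ = C * |q s * w s| * (q s / s) := by rw [abs_mul, abs_of_pos hqs]; ring
      _ ≤ _ := by gcongr; exact hbound s hs
  have hd : ∀ σ : ℝ, ∀ s, R₀ ≤ s → HasDerivAt (fun t => y t + σ * (C * S / ε * q t))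
      (s * g s + σ * (-(C * S * (q s / s)))) s := fun σ s hs => by
    refine ((hyd s (hq0 s hs)).add
      (((hqd s (hq0 s hs)).const_mul (C * S / ε)).const_mul σ)).congr_deriv ?_
    field_simp
  have hup : AntitoneOn (fun t => y t + 1 * (C * S / ε * q t)) (Ici R₀) := by
    refine antitoneOn_of_hasDerivWithinAt_nonpos (convex_Ici R₀)
      (fun s hs => (hd 1 s hs).continuousAt.continuousWithinAt)
      (fun s hs => (hd 1 s (interior_subset hs)).hasDerivWithinAt) fun s hs => ?_
    have := (abs_le.1 (hder s (interior_subset hs))).2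
    linarith
  have hdown : MonotoneOn (fun t => y t + (-1) * (C * S / ε * q t)) (Ici R₀) := by
    refine monotoneOn_of_hasDerivWithinAt_nonneg (convex_Ici R₀)
      (fun s hs => (hd (-1) s hs).continuousAt.continuousWithinAt)
      (fun s hs => (hd (-1) s (interior_subset hs)).hasDerivWithinAt) fun s hs => ?_
    have := (abs_le.1 (hder s (interior_subset hs))).1
    linarith
  have h1 := hup hR (hR.trans hr) hr
  have h2 := hdown hR (hR.trans hr) hr
  have h4 : 0 ≤ C * S / ε * q r := by
    have := hqp r (hq0 r (hR.trans hr))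
    positivity
  have h5 : C * (|w R₀| + |R₀ * p R₀|) * exp ((1 + C) / ε) / ε * q R = C * S / ε * q R := by
    rw [hS]; ring
  rw [h5, abs_le]
  simp only [hy] at h1 h2
  constructor <;> linarith

end IsRadial

theorem exp_two_mul_sub_le (x y : ℝ) :
    exp (2 * x) - exp (2 * y) ≤ exp (2 * x) * (2 * (x - y)) := by
  have h := add_one_le_exp (2 * y - 2 * x)
  have e : exp (2 * y) = exp (2 * x) * exp (2 * y - 2 * x) := by rw [← exp_add]; ring_nf
  rw [e]
  nlinarith [exp_pos (2 * x)]

theorem abs_exp_two_mul_sub_le {x y M : ℝ} (hx : x ≤ M) (hy : y ≤ M) :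
    |exp (2 * x) - exp (2 * y)| ≤ 2 * exp (2 * M) * |x - y| := by
  have hx' : exp (2 * x) ≤ exp (2 * M) := by gcongr
  have hy' : exp (2 * y) ≤ exp (2 * M) := by gcongr
  have h1 := exp_two_mul_sub_le x y
  have h2 := exp_two_mul_sub_le y x
  have h3 := exp_pos (2 * x)
  have h4 := exp_pos (2 * y)
  have h5 := le_abs_self (x - y)
  have h6 := neg_abs_le (x - y)
  have h7 := abs_nonneg (x - y)
  rw [abs_le]
  constructor <;> nlinarith

theorem abs_exp_two_mul_taylor_le {x y M : ℝ} (hx : x ≤ M) (hy : y ≤ M) :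
    |exp (2 * x) - exp (2 * y) - 2 * exp (2 * y) * (x - y)| ≤ 4 * exp (2 * M) * |x - y| ^ 2 := by
  have h1 := exp_two_mul_sub_le x y
  have h2 := exp_two_mul_sub_le y x
  have h3 : (exp (2 * x) - exp (2 * y)) * (x - y) ≤ 2 * exp (2 * M) * |x - y| ^ 2 := by
    calc _ ≤ |exp (2 * x) - exp (2 * y)| * |x - y| := (le_abs_self _).trans (abs_mul _ _).le
      _ ≤ 2 * exp (2 * M) * |x - y| * |x - y| := by
        gcongr; exact abs_exp_two_mul_sub_le hx hy
      _ = _ := by ring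
  rw [abs_of_nonneg (by nlinarith)]
  nlinarith

/-- The radial Liouville equation with weight `(1 + r²)^N`. -/
def IsRadialLiouville (N : ℝ) (u p : ℝ → ℝ) : Prop :=
  IsRadial u p fun r => -((1 + r ^ 2) ^ N * exp (2 * u r))

/-- The linearization at `u` of the radial Liouville equation with weight `(1 + r²)^N`. -/
def IsRadialLinearized (N : ℝ) (u φ ψ : ℝ → ℝ) : Prop :=
  IsRadial φ ψ fun r => -(2 * (1 + r ^ 2) ^ N * exp (2 * u r) * φ r)

section Liouville

variable {N : ℝ} {u p v q : ℝ → ℝ}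

theorem IsRadialLiouville.antitoneOn_mul_deriv (hu : IsRadialLiouville N u p) :
    AntitoneOn (fun r => r * p r) (Ici 0) := by
  refine antitoneOn_of_hasDerivWithinAt_nonpos (convex_Ici 0)
    (IsRadial.continuousOn_mul_deriv hu) (fun r hr => (IsRadial.hasDerivAt_mul_deriv hu
      (by simpa using hr)).hasDerivWithinAt) fun r hr => ?_
  have hr : 0 < r := by simpa using hr
  have : 0 ≤ r * ((1 + r ^ 2) ^ N * exp (2 * u r)) := by positivity
  linarith

theorem IsRadialLiouville.le_apply_zero (hu : IsRadialLiouville N u p) {r : ℝ} (hr : 0 ≤ r) : u r ≤ u 0 := by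
  have hanti : AntitoneOn u (Ici 0) := by
    refine antitoneOn_of_hasDerivWithinAt_nonpos (convex_Ici 0) (IsRadial.cont hu)
      (fun r hr => (IsRadial.hasDerivAt hu r (by simpa using hr)).hasDerivWithinAt) fun r hr => ?_
    have hr : 0 < r := by simpa using hr
    have := hu.antitoneOn_mul_deriv self_mem_Ici hr.le hr.le
    simp only [zero_mul] at this
    exact nonpos_of_mul_nonpos_right this hr
  exact hanti self_mem_Ici hr hr

theorem one_add_sq_rpow_le (hN : 0 ≤ N) {r R : ℝ} (hr : 0 ≤ r) (hrR : r ≤ R) :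
    (1 + r ^ 2) ^ N ≤ (1 + R ^ 2) ^ N := by
  gcongr

theorem exists_liouville_sub_le (hN : 0 ≤ N) (M R : ℝ) : ∃ C, 0 ≤ C ∧ ∀ u p v q : ℝ → ℝ,
    IsRadialLiouville N u p → IsRadialLiouville N v q → u 0 ≤ M → v 0 ≤ M → ∀ r, 0 ≤ r → r ≤ R →
      |u r - v r| ≤ C * |u 0 - v 0| ∧ |p r - q r| ≤ C * |u 0 - v 0| := by
  set A := (1 + R ^ 2) ^ N * (2 * exp (2 * M))
  refine ⟨exp ((A + 2) * R), by positivity, fun u p v q hu hv hu0 hv0 r hr hrR => ?_⟩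
  have h := (IsRadial.sub hu hv).abs_le_of_abs_le (R := R) (A := A) (B := 0) (by positivity) le_rfl
    (fun s hs hsR => ?_) hr hrR
  · simpa [mul_comm] using h
  · have e : -((1 + s ^ 2) ^ N * exp (2 * u s)) - -((1 + s ^ 2) ^ N * exp (2 * v s))
        = -((1 + s ^ 2) ^ N * (exp (2 * u s) - exp (2 * v s))) := by ring
    rw [e, abs_neg, abs_mul, abs_of_nonneg (by positivity), add_zero, mul_assoc]
    gcongr
    exact abs_exp_two_mul_sub_le ((hu.le_apply_zero hs.le).trans hu0)
      ((hv.le_apply_zero hs.le).trans hv0)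

theorem IsRadialLiouville.abs_linearized_le (hN : 0 ≤ N) (hu : IsRadialLiouville N u p) {M R : ℝ}
    (hM : u 0 ≤ M) (φ : ℝ → ℝ) {r : ℝ} (hr : 0 ≤ r) (hrR : r ≤ R) :
    |-(2 * (1 + r ^ 2) ^ N * exp (2 * u r) * φ r)| ≤
      2 * (1 + R ^ 2) ^ N * exp (2 * M) * |φ r| := by
  rw [abs_neg, abs_mul, abs_of_nonneg (by positivity)]
  gcongr
  exact (hu.le_apply_zero hr).trans hM

theorem exists_linearized_le (hN : 0 ≤ N) (M R : ℝ) : ∃ C, 0 ≤ C ∧ ∀ u p φ ψ : ℝ → ℝ,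
    IsRadialLiouville N u p → IsRadialLinearized N u φ ψ → u 0 ≤ M → φ 0 = 1 → ∀ r, 0 ≤ r → r ≤ R →
      |φ r| ≤ C ∧ |ψ r| ≤ C := by
  set A := 2 * (1 + R ^ 2) ^ N * exp (2 * M)
  refine ⟨exp ((A + 2) * R), by positivity, fun u p φ ψ hu hφ hu0 hφ0 r hr hrR => ?_⟩
  have h := IsRadial.abs_le_of_abs_le hφ (R := R) (A := A) (B := 0) (by positivity) le_rfl
    (fun s hs hsR => ?_) hr hrR
  · simpa [hφ0] using h
  · rw [add_zero]
    exact hu.abs_linearized_le hN hu0 φ hs.le hsR.le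

theorem exists_linearized_sub_le (hN : 0 ≤ N) (M R : ℝ) :
    ∃ C, 0 ≤ C ∧ ∀ u p v q φ ψ χ η : ℝ → ℝ,
      IsRadialLiouville N u p → IsRadialLiouville N v q → IsRadialLinearized N u φ ψ → IsRadialLinearized N v χ η →
      u 0 ≤ M → v 0 ≤ M → φ 0 = 1 → χ 0 = 1 → ∀ r, 0 ≤ r → r ≤ R →
      |φ r - χ r| ≤ C * |u 0 - v 0| ∧ |ψ r - η r| ≤ C * |u 0 - v 0| := by
  obtain ⟨C₁, hC₁, H₁⟩ := exists_liouville_sub_le hN M R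
  obtain ⟨C₂, hC₂, H₂⟩ := exists_linearized_le hN M R
  set A := 2 * (1 + R ^ 2) ^ N * exp (2 * M)
  set D := 2 * (1 + R ^ 2) ^ N * (2 * exp (2 * M) * C₁) * C₂
  refine ⟨D * exp ((A + 2) * R), by positivity,
    fun u p v q φ ψ χ η hu hv hφ hχ hu0 hv0 hφ0 hχ0 r hr hrR => ?_⟩
  have h := (IsRadial.sub hφ hχ).abs_le_of_abs_le (R := R) (A := A) (B := D * |u 0 - v 0|)
    (by positivity) (by positivity) (fun s hs hsR => ?_) hr hrR
  · simp only [hφ0, hχ0, sub_self, abs_zero, zero_add] at h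
    rw [mul_right_comm]
    exact h
  · have e : -(2 * (1 + s ^ 2) ^ N * exp (2 * u s) * φ s) -
        -(2 * (1 + s ^ 2) ^ N * exp (2 * v s) * χ s)
        = -(2 * (1 + s ^ 2) ^ N * exp (2 * u s) * (φ s - χ s)) +
          -(2 * (1 + s ^ 2) ^ N * (exp (2 * u s) - exp (2 * v s)) * χ s) := by ring
    rw [e]
    refine (abs_add_le _ _).trans (add_le_add ?_ ?_)
    · exact hu.abs_linearized_le hN hu0 (fun s => φ s - χ s) hs.le hsR.le
    · have h1 := abs_exp_two_mul_sub_le ((hu.le_apply_zero hs.le).trans hu0)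
        ((hv.le_apply_zero hs.le).trans hv0)
      have h2 := (H₁ u p v q hu hv hu0 hv0 s hs.le hsR.le).1
      have h3 := (H₂ v q χ η hv hχ hv0 hχ0 s hs.le hsR.le).1
      rw [abs_neg, abs_mul, abs_mul, abs_of_nonneg (by positivity)]
      calc 2 * (1 + s ^ 2) ^ N * |exp (2 * u s) - exp (2 * v s)| * |χ s|
          ≤ 2 * (1 + R ^ 2) ^ N * (2 * exp (2 * M) * (C₁ * |u 0 - v 0|)) * C₂ := by
            gcongr
            exact h1.trans (by gcongr)
        _ = D * |u 0 - v 0| := by simp only [D]; ring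

theorem exists_liouville_taylor_le (hN : 0 ≤ N) (M R : ℝ) :
    ∃ C, 0 ≤ C ∧ ∀ u p v q φ ψ : ℝ → ℝ,
      IsRadialLiouville N u p → IsRadialLiouville N v q → IsRadialLinearized N u φ ψ →
      u 0 ≤ M → v 0 ≤ M → φ 0 = 1 → ∀ r, 0 ≤ r → r ≤ R →
      |q r - p r - (v 0 - u 0) * ψ r| ≤ C * |v 0 - u 0| ^ 2 := by
  obtain ⟨C₁, hC₁, H₁⟩ := exists_liouville_sub_le hN M R
  set A := 2 * (1 + R ^ 2) ^ N * exp (2 * M)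
  set D := (1 + R ^ 2) ^ N * (4 * exp (2 * M) * C₁ ^ 2)
  refine ⟨D * exp ((A + 2) * R), by positivity,
    fun u p v q φ ψ hu hv hφ hu0 hv0 hφ0 r hr hrR => ?_⟩
  have h := ((IsRadial.sub hv hu).sub (IsRadial.const_mul (v 0 - u 0) hφ)).abs_le_of_abs_le
    (R := R) (A := A) (B := D * |v 0 - u 0| ^ 2)
    (by positivity) (by positivity) (fun s hs hsR => ?_) hr hrR
  · simp only [hφ0, mul_one, sub_self, abs_zero, zero_add] at h
    rw [mul_right_comm]
    exact h.2
  · have e : -((1 + s ^ 2) ^ N * exp (2 * v s)) - -((1 + s ^ 2) ^ N * exp (2 * u s)) -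
        (v 0 - u 0) * -(2 * (1 + s ^ 2) ^ N * exp (2 * u s) * φ s)
        = -(2 * (1 + s ^ 2) ^ N * exp (2 * u s) * (v s - u s - (v 0 - u 0) * φ s)) +
          -((1 + s ^ 2) ^ N *
            (exp (2 * v s) - exp (2 * u s) - 2 * exp (2 * u s) * (v s - u s))) := by ring
    rw [e]
    refine (abs_add_le _ _).trans (add_le_add ?_ ?_)
    · exact hu.abs_linearized_le hN hu0 (fun s => v s - u s - (v 0 - u 0) * φ s) hs.le hsR.le
    · have h1 := abs_exp_two_mul_taylor_le ((hv.le_apply_zero hs.le).trans hv0)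
        ((hu.le_apply_zero hs.le).trans hu0)
      have h2 := (H₁ v q u p hv hu hv0 hu0 s hs.le hsR.le).1
      rw [abs_neg, abs_mul, abs_of_nonneg (by positivity)]
      calc (1 + s ^ 2) ^ N * |exp (2 * v s) - exp (2 * u s) - 2 * exp (2 * u s) * (v s - u s)|
          ≤ (1 + R ^ 2) ^ N * (4 * exp (2 * M) * (C₁ * |v 0 - u 0|) ^ 2) := by
            gcongr
            exact h1.trans (by gcongr)
        _ = D * |v 0 - u 0| ^ 2 := by simp only [D]; ring

/-- A nontrivial solution of the linearized equation has only simple zeroes. -/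
theorem IsRadialLinearized.deriv_ne_zero (hN : 0 ≤ N) (hu : IsRadialLiouville N u p) {φ ψ : ℝ → ℝ}
    (hφ : IsRadialLinearized N u φ ψ) (hφ0 : φ 0 ≠ 0) {r : ℝ} (hr : 0 < r) (h : φ r = 0) :
    ψ r ≠ 0 := fun h' =>
  hφ0 (IsRadial.eq_zero_of_deriv_eq_zero hφ hr
    (A := 2 * (1 + r ^ 2) ^ N * exp (2 * u 0)) (by positivity)
    (fun _ hs hsr => hu.abs_linearized_le hN le_rfl φ hs.le hsr.le) h h')

end Liouville

section Decay

variable {N : ℝ} {u p : ℝ → ℝ}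

theorem IsRadialLiouville.tendsto_mul_deriv (hN : 0 ≤ N) (hu : IsRadialLiouville N u p)
    (hint : IntegrableOn (fun r => (1 + r ^ 2) ^ N * exp (2 * u r) * r) (Ioi 0)) :
    Tendsto (fun r => r * p r) atTop
      (𝓝 (-∫ r in Ioi (0 : ℝ), (1 + r ^ 2) ^ N * exp (2 * u r) * r)) := by
  refine (intervalIntegral_tendsto_integral_Ioi 0 hint tendsto_id).neg.congr' ?_
  filter_upwards [eventually_ge_atTop 0] with R hR
  have h := intervalIntegral.integral_eq_sub_of_hasDerivAt_of_le hR
    ((IsRadial.continuousOn_mul_deriv hu).mono Icc_subset_Ici_self)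
    (fun r hr => IsRadial.hasDerivAt_mul_deriv hu hr.1) (by
      apply ContinuousOn.intervalIntegrable_of_Icc hR
      have := (IsRadial.cont hu).mono (Icc_subset_Ici_self : Icc 0 R ⊆ Ici 0)
      refine continuousOn_id.mul (ContinuousOn.neg (ContinuousOn.mul ?_ (by fun_prop)))
      exact ContinuousOn.rpow_const (by fun_prop) fun _ _ => Or.inr hN)
  simp only [zero_mul, sub_zero] at h
  rw [← h, ← intervalIntegral.integral_neg, id]
  congr 1
  ext r
  ring

theorem IsRadialLiouville.exists_lt_neg_mul_deriv (hN : 0 ≤ N) (hu : IsRadialLiouville N u p)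
    (hint : IntegrableOn (fun r => (1 + r ^ 2) ^ N * exp (2 * u r) * r) (Ioi 0)) :
    ∃ R, 1 ≤ R ∧ N + 1 < -(R * p R) := by
  by_contra! hcon
  have hmono : MonotoneOn (fun r => u r + (N + 1) * log r) (Ici 1) := by
    have hd : ∀ r : ℝ, 1 ≤ r →
        HasDerivAt (fun r => u r + (N + 1) * log r) (p r + (N + 1) * r⁻¹) r := fun r hr =>
      (IsRadial.hasDerivAt hu r (by linarith)).add
        ((hasDerivAt_log (by linarith : r ≠ 0)).const_mul (N + 1))
    refine monotoneOn_of_hasDerivWithinAt_nonneg (convex_Ici 1)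
      (fun r hr => (hd r hr).continuousAt.continuousWithinAt)
      (fun r hr => (hd r (interior_subset hr)).hasDerivWithinAt) fun r hr => ?_
    have hr : 1 ≤ r := interior_subset hr
    have h1 := hcon r hr
    have e : p r + (N + 1) * r⁻¹ = (r * p r + (N + 1)) * r⁻¹ := by
      have : r ≠ 0 := by linarith
      field_simp
    rw [e]
    have : 0 ≤ r⁻¹ := by positivity
    apply mul_nonneg _ this
    linarith
  refine not_integrableOn_Ioi_inv (a := 1) ?_
  have hint' := (hint.mono_set (Ioi_subset_Ioi zero_le_one)).const_mul (exp (-(2 * u 1)))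
  refine Integrable.mono' hint' (by fun_prop) ?_
  filter_upwards [ae_restrict_mem measurableSet_Ioi] with r hr
  have hr1 : (1 : ℝ) < r := hr
  have hr0 : 0 < r := by linarith
  have h := hmono self_mem_Ici hr1.le hr1.le
  simp only [log_one, mul_zero, add_zero] at h
  rw [norm_of_nonneg (by positivity)]
  have h1 : exp (2 * N * log r) ≤ (1 + r ^ 2) ^ N := by
    calc exp (2 * N * log r) = (r ^ 2) ^ N := by
          rw [rpow_def_of_pos (by positivity), log_pow]; push_cast; ring_nf
      _ ≤ _ := by gcongr; linarith
  calc r⁻¹ = exp (-log r) := by rw [exp_neg, exp_log hr0]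
    _ ≤ exp (-(2 * u 1) + (2 * N * log r + 2 * u r + log r)) := by
      gcongr; linarith
    _ = exp (-(2 * u 1)) * (exp (2 * N * log r) * exp (2 * u r) * r) := by
      rw [exp_add, exp_add, exp_add, exp_log hr0]
    _ ≤ _ := by gcongr

/-- The nonlinearity decays at infinity, locally uniformly in the initial value. -/
theorem IsRadialLiouville.exists_decay (hN : 0 ≤ N) (hu : IsRadialLiouville N u p)
    (hint : IntegrableOn (fun r => (1 + r ^ 2) ^ N * exp (2 * u r) * r) (Ioi 0)) :
    ∃ ε : ℝ, 0 < ε ∧ ∃ R₀, 1 ≤ R₀ ∧ ∃ C, 0 ≤ C ∧ ∃ δ > 0, δ ≤ 1 ∧ ∀ v q : ℝ → ℝ,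
      IsRadialLiouville N v q → |v 0 - u 0| < δ → ∀ r, R₀ ≤ r →
      r * ((1 + r ^ 2) ^ N * exp (2 * v r)) ≤ C * (r ^ (-ε)) ^ 2 / r := by
  obtain ⟨R₀, hR₀, hlt⟩ := hu.exists_lt_neg_mul_deriv hN hint
  obtain ⟨C₁, hC₁, H₁⟩ := exists_liouville_sub_le hN (u 0 + 1) R₀
  set ε := (-(R₀ * p R₀) - (N + 1)) / 2 with hε
  have hε0 : 0 < ε := by rw [hε]; linarith
  have hR0 : 0 < R₀ := by linarith
  refine ⟨ε, hε0, R₀, hR₀, exp (N * log 2 + 2 * (u 0 + 1) + 2 * (N + 1 + ε) * log R₀),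
    by positivity, min 1 (ε / (R₀ * C₁ + 1)), by positivity, min_le_left _ _,
    fun v q hv hv0 r hr => ?_⟩
  have hv1 : |v 0 - u 0| ≤ 1 := hv0.le.trans (min_le_left _ _)
  have hv2 : (R₀ * C₁ + 1) * |v 0 - u 0| ≤ ε := by
    rw [← le_div_iff₀' (by positivity)]
    exact hv0.le.trans (min_le_right _ _)
  have hvM : v 0 ≤ u 0 + 1 := by linarith [(abs_le.1 hv1).2]
  have hq : R₀ * q R₀ ≤ -(N + 1 + ε) := by
    have h1 := (H₁ v q u p hv hu hvM (by linarith) R₀ hR0.le le_rfl).2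
    have h2 : R₀ * |q R₀ - p R₀| ≤ R₀ * (C₁ * |v 0 - u 0|) := by gcongr
    have h3 : R₀ * (q R₀ - p R₀) ≤ R₀ * |q R₀ - p R₀| := by gcongr; exact le_abs_self _
    have h4 := abs_nonneg (v 0 - u 0)
    have h5 : -(R₀ * p R₀) = N + 1 + 2 * ε := by rw [hε]; ring
    linarith
  have hanti : AntitoneOn (fun r => v r + (N + 1 + ε) * log r) (Ici R₀) := by
    have hd : ∀ r : ℝ, R₀ ≤ r →
        HasDerivAt (fun r => v r + (N + 1 + ε) * log r) (q r + (N + 1 + ε) * r⁻¹) r :=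
      fun r hr => (IsRadial.hasDerivAt hv r (by linarith)).add
        ((hasDerivAt_log (by linarith : r ≠ 0)).const_mul (N + 1 + ε))
    refine antitoneOn_of_hasDerivWithinAt_nonpos (convex_Ici R₀)
      (fun r hr => (hd r hr).continuousAt.continuousWithinAt)
      (fun r hr => (hd r (interior_subset hr)).hasDerivWithinAt) fun r hr => ?_
    have hr : R₀ ≤ r := interior_subset hr
    have hr0 : 0 < r := by linarith
    have h1 := hv.antitoneOn_mul_deriv hR0.le hr0.le hr
    simp only at h1
    have e : q r + (N + 1 + ε) * r⁻¹ = (r * q r + (N + 1 + ε)) * r⁻¹ := by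
      field_simp
    rw [e]
    exact mul_nonpos_of_nonpos_of_nonneg (by linarith) (by positivity)
  have hr0 : 0 < r := by linarith
  have hvr := hanti self_mem_Ici hr hr
  simp only at hvr
  have hvR := hv.le_apply_zero hR0.le
  have h1 : (1 + r ^ 2) ^ N ≤ exp (N * log 2 + 2 * N * log r) := by
    calc (1 + r ^ 2) ^ N ≤ (2 * r ^ 2) ^ N := by gcongr; nlinarith
      _ = _ := by
        rw [rpow_def_of_pos (by positivity), log_mul (by norm_num) (by positivity), log_pow]
        push_cast; ring_nf
  have h2 : exp (2 * v r) ≤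
      exp (2 * (u 0 + 1) + 2 * (N + 1 + ε) * log R₀ - 2 * (N + 1 + ε) * log r) := by
    gcongr; linarith
  have e : exp (N * log 2 + 2 * (u 0 + 1) + 2 * (N + 1 + ε) * log R₀) * (r ^ (-ε)) ^ 2 / r
      = r * (exp (N * log 2 + 2 * N * log r) *
        exp (2 * (u 0 + 1) + 2 * (N + 1 + ε) * log R₀ - 2 * (N + 1 + ε) * log r)) := by
    rw [rpow_def_of_pos hr0, ← exp_nat_mul]
    rw [div_eq_iff hr0.ne']
    have hrr : r = exp (log r) := (exp_log hr0).symm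
    generalize log r = l at *
    subst hrr
    simp only [← exp_add]
    push_cast; ring_nf
  rw [e]
  gcongr

/-- Locally uniform asymptotics at infinity for differences of solutions of the Liouville equation
and for solutions of the linearized equation. -/
theorem IsRadialLiouville.exists_tail_le (hN : 0 ≤ N) (hu : IsRadialLiouville N u p)
    (hint : IntegrableOn (fun r => (1 + r ^ 2) ^ N * exp (2 * u r) * r) (Ioi 0)) :
    ∃ ε : ℝ, 0 < ε ∧ ∃ R₀, 1 ≤ R₀ ∧ ∃ M, 0 ≤ M ∧ ∃ δ > 0, δ ≤ 1 ∧ ∀ v q : ℝ → ℝ,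
      IsRadialLiouville N v q → |v 0 - u 0| < δ → ∀ R r, R₀ ≤ R → R ≤ r →
      |r * (q r - p r) - R * (q R - p R)| ≤ M * R ^ (-ε) * |v 0 - u 0| ∧
      ∀ φ ψ : ℝ → ℝ, IsRadialLinearized N v φ ψ → φ 0 = 1 →
        |r * ψ r - R * ψ R| ≤ M * R ^ (-ε) := by
  obtain ⟨ε, hε, R₀, hR₀, C, hC, δ, hδ, hδ1, H⟩ := hu.exists_decay hN hint
  obtain ⟨C₁, hC₁, H₁⟩ := exists_liouville_sub_le hN (u 0 + 1) R₀
  obtain ⟨C₂, hC₂, H₂⟩ := exists_linearized_le hN (u 0 + 1) R₀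
  have hR0 : 0 < R₀ := by linarith
  refine ⟨ε, hε, R₀, hR₀,
    2 * C * ((1 + R₀) * (C₁ + C₂)) * exp ((1 + 2 * C) / ε) / ε, by positivity, δ, hδ, hδ1,
    fun v q hv hv0 R r hR hr => ?_⟩
  have hvM : v 0 ≤ u 0 + 1 := by linarith [(abs_lt.1 hv0).2]
  have hRp : 0 < R := by linarith
  have hq := rpow_pos_of_pos hRp (-ε)
  constructor
  · have h := (IsRadial.sub hv hu).abs_mul_deriv_sub_le hR₀ (C := 2 * C) (by positivity) hε
      (fun s hs => ?_) hR hr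
    · refine h.trans ?_
      obtain ⟨h1, h2⟩ := H₁ v q u p hv hu hvM (by linarith) R₀ hR0.le le_rfl
      have h3 : |v R₀ - u R₀| + |R₀ * (q R₀ - p R₀)| ≤
          (1 + R₀) * (C₁ + C₂) * |v 0 - u 0| := by
        rw [abs_mul, abs_of_pos hR0]
        calc _ ≤ C₁ * |v 0 - u 0| + R₀ * (C₁ * |v 0 - u 0|) := by gcongr
          _ = (1 + R₀) * (C₁ + 0) * |v 0 - u 0| := by ring
          _ ≤ _ := by gcongr
      calc _ ≤ 2 * C * ((1 + R₀) * (C₁ + C₂) * |v 0 - u 0|) * exp ((1 + 2 * C) / ε) / ε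
            * R ^ (-ε) := by gcongr
        _ = _ := by ring
    · have hs0 : 0 < s := by linarith
      have e : s * (-((1 + s ^ 2) ^ N * exp (2 * v s)) - -((1 + s ^ 2) ^ N * exp (2 * u s)))
          = -(s * (1 + s ^ 2) ^ N * (exp (2 * v s) - exp (2 * u s))) := by ring
      have h1 := abs_exp_two_mul_sub_le (le_max_left (v s) (u s)) (le_max_right (v s) (u s))
      have h2 : s * ((1 + s ^ 2) ^ N * exp (2 * max (v s) (u s))) ≤ C * (s ^ (-ε)) ^ 2 / s := by
        rcases max_choice (v s) (u s) with h | h <;> rw [h]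
        · exact H v q hv hv0 s hs
        · exact H u p hu (by simpa using hδ) s hs
      rw [e, abs_neg, abs_mul, abs_of_nonneg (by positivity)]
      calc _ ≤ s * (1 + s ^ 2) ^ N * (2 * exp (2 * max (v s) (u s)) * |v s - u s|) := by gcongr
        _ = 2 * (s * ((1 + s ^ 2) ^ N * exp (2 * max (v s) (u s)))) * |v s - u s| := by ring
        _ ≤ 2 * (C * (s ^ (-ε)) ^ 2 / s) * |v s - u s| := by gcongr
        _ = _ := by ring
  · intro φ ψ hφ hφ0
    have h := IsRadial.abs_mul_deriv_sub_le hφ hR₀ (C := 2 * C) (by positivity) hε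
      (fun s hs => ?_) hR hr
    · refine h.trans ?_
      obtain ⟨h1, h2⟩ := H₂ v q φ ψ hv hφ hvM hφ0 R₀ hR0.le le_rfl
      have h3 : |φ R₀| + |R₀ * ψ R₀| ≤ (1 + R₀) * (C₁ + C₂) := by
        rw [abs_mul, abs_of_pos hR0]
        calc _ ≤ C₂ + R₀ * C₂ := by gcongr
          _ = (1 + R₀) * (0 + C₂) := by ring
          _ ≤ _ := by gcongr
      gcongr
    · have hs0 : 0 < s := by linarith
      have h2 := H v q hv hv0 s hs
      have e : s * -(2 * (1 + s ^ 2) ^ N * exp (2 * v s) * φ s)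
          = -(2 * (s * ((1 + s ^ 2) ^ N * exp (2 * v s))) * φ s) := by ring
      rw [e, abs_neg, abs_mul, abs_of_nonneg (by positivity)]
      calc _ ≤ 2 * (C * (s ^ (-ε)) ^ 2 / s) * |φ s| := by gcongr
        _ = _ := by ring

end Decay

section Family

variable {N : ℝ} {u p φ ψ : ℝ → ℝ → ℝ} {α : ℝ → ℝ}

theorem abs_deriv_mass_add_le (hN : 0 ≤ N) (hu : ∀ a, IsRadialLiouville N (u a) (p a))
    (hu0 : ∀ a, u a 0 = a) (hφ : ∀ a, IsRadialLinearized N (u a) (φ a) (ψ a))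
    (hφ0 : ∀ a, φ a 0 = 1) (hα : ∀ a, Tendsto (fun r => r * p a r) atTop (𝓝 (-α a)))
    {a d : ℝ} (hd : HasDerivAt α d a) {R δ E : ℝ} (hR : 0 ≤ R) (hδ : 0 < δ)
    (htail : ∀ b, |b - a| < δ → ∀ r, R ≤ r →
      |r * (p b r - p a r) - R * (p b R - p a R)| ≤ E * |b - a|) :
    |d + R * ψ a R| ≤ E := by
  obtain ⟨C, hC, H⟩ := exists_liouville_taylor_le hN (a + 1) R
  have hlim : ∀ b, |b - a| < δ → |α b - α a + R * (p b R - p a R)| ≤ E * |b - a| := by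
    intro b hb
    have h1 : Tendsto (fun r => |r * (p b r - p a r) - R * (p b R - p a R)|) atTop
        (𝓝 |(-α b - -α a) - R * (p b R - p a R)|) := by
      refine Tendsto.abs (Tendsto.sub_const ?_ _)
      exact ((hα b).sub (hα a)).congr fun r => by ring
    have h2 := le_of_tendsto h1 ((eventually_ge_atTop R).mono (htail b hb))
    have e : α b - α a + R * (p b R - p a R) = -(-α b - -α a - R * (p b R - p a R)) := by ring
    rwa [e, abs_neg]
  have hquot : ∀ᶠ b in 𝓝[≠] a, |slope α a b + R * ψ a R| ≤ E + R * C * |b - a| := by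
    have hnear : ∀ᶠ b in 𝓝[≠] a, |b - a| < min δ 1 := by
      apply nhdsWithin_le_nhds
      filter_upwards [Metric.ball_mem_nhds a (show 0 < min δ 1 by positivity)] with b hb
      simpa [Real.dist_eq] using hb
    filter_upwards [hnear, self_mem_nhdsWithin] with b hb hba
    have hba : b - a ≠ 0 := sub_ne_zero.2 hba
    have hpos : 0 < |b - a| := abs_pos.2 hba
    have h1 := hlim b (hb.trans_le (min_le_left _ _))
    have hb1 := (abs_lt.1 (hb.trans_le (min_le_right _ _))).2
    have h2 := H (u a) (p a) (u b) (p b) (φ a) (ψ a) (hu a) (hu b) (hφ a)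
      (by rw [hu0]; linarith) (by rw [hu0]; linarith) (hφ0 a) R hR le_rfl
    rw [hu0, hu0] at h2
    have e : (slope α a b + R * ψ a R) * (b - a) = (α b - α a + R * (p b R - p a R))
        - R * (p b R - p a R - (b - a) * ψ a R) := by
      rw [slope_def_field]
      field_simp
      ring
    refine le_of_mul_le_mul_right ?_ hpos
    rw [← abs_mul, e]
    calc _ ≤ |α b - α a + R * (p b R - p a R)| + |R * (p b R - p a R - (b - a) * ψ a R)| :=
          abs_sub _ _
      _ ≤ E * |b - a| + R * (C * |b - a| ^ 2) := by
          rw [abs_mul R, abs_of_nonneg hR]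
          gcongr
      _ = _ := by ring
  have hl : Tendsto (fun b => |slope α a b + R * ψ a R|) (𝓝[≠] a) (𝓝 |d + R * ψ a R|) :=
    ((hasDerivAt_iff_tendsto_slope.1 hd).add_const _).abs
  have hr : Tendsto (fun b => E + R * C * |b - a|) (𝓝[≠] a) (𝓝 E) := by
    have : Continuous fun b => E + R * C * |b - a| := by fun_prop
    simpa using (this.tendsto a).mono_left nhdsWithin_le_nhds
  exact le_of_tendsto_of_tendsto hl hr hquot

/-- If the mass has nonzero derivative at `a`, the solutions of the linearized equation with
parameter near `a` have no large zeroes. -/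
theorem exists_forall_linearized_ne_zero (hN : 0 ≤ N)
    (hu : ∀ a, IsRadialLiouville N (u a) (p a))
    (hu0 : ∀ a, u a 0 = a) (hφ : ∀ a, IsRadialLinearized N (u a) (φ a) (ψ a))
    (hφ0 : ∀ a, φ a 0 = 1) (hα : ∀ a, Tendsto (fun r => r * p a r) atTop (𝓝 (-α a)))
    {a d : ℝ} (hint : IntegrableOn (fun r => (1 + r ^ 2) ^ N * exp (2 * u a r) * r) (Ioi 0))
    (hd : HasDerivAt α d a) (hd0 : d ≠ 0) :
    ∃ R > 0, ∃ δ > 0, ∀ b, |b - a| < δ → ∀ r, R ≤ r → φ b r ≠ 0 := by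
  obtain ⟨ε, hε, R₀, hR₀, M, hM, δ, hδ, hδ1, H⟩ := (hu a).exists_tail_le hN hint
  have hdpos : 0 < |d| := abs_pos.2 hd0
  obtain ⟨R, hR, hRsmall⟩ : ∃ R, R₀ ≤ R ∧ M * R ^ (-ε) ≤ |d| / 8 := by
    have h0 : Tendsto (fun R : ℝ => M * R ^ (-ε)) atTop (𝓝 (M * 0)) :=
      (tendsto_rpow_neg_atTop hε).const_mul M
    rw [mul_zero] at h0
    exact ((eventually_ge_atTop R₀).and
      (h0.eventually_le_const (by positivity : 0 < |d| / 8))).exists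
  have hRp : 0 < R := by linarith
  have ha := abs_deriv_mass_add_le hN hu hu0 hφ hφ0 hα hd hRp.le hδ (E := M * R ^ (-ε))
    fun b hb r hr => by
      have := (H (u b) (p b) (hu b) (by rwa [hu0, hu0]) R r hR hr).1
      rwa [hu0, hu0] at this
  obtain ⟨C, hC, HC⟩ := exists_linearized_sub_le hN (a + 1) R
  set δ' := min δ (|d| / 4 / (R * C + 1)) with hδ'
  have hδ'0 : 0 < δ' := by positivity
  have hder : ∀ b, |b - a| < δ' → ∀ r, R ≤ r → d * (r * ψ b r) ≤ -(d ^ 2 / 2) := by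
    intro b hb r hr
    have hb1 : |b - a| < δ := hb.trans_le (min_le_left _ _)
    have hb2 : (R * C + 1) * |b - a| ≤ |d| / 4 := by
      rw [← le_div_iff₀' (by positivity)]
      exact hb.le.trans (min_le_right _ _)
    have hbM := (abs_lt.1 (hb1.trans_le hδ1)).2
    have h1 := (H (u b) (p b) (hu b) (by rwa [hu0, hu0]) R r hR hr).2 (φ b) (ψ b) (hφ b) (hφ0 b)
    have h2 := (HC (u b) (p b) (u a) (p a) (φ b) (ψ b) (φ a) (ψ a) (hu b) (hu a) (hφ b) (hφ a)
      (by rw [hu0]; linarith) (by rw [hu0]; linarith) (hφ0 b) (hφ0 a) R hRp.le le_rfl).2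
    rw [hu0, hu0] at h2
    have h3 : |R * (ψ b R - ψ a R)| ≤ R * (C * |b - a|) := by
      rw [abs_mul, abs_of_pos hRp]; gcongr
    have h4 : |d + r * ψ b r| ≤ |d| / 2 := by
      have e : d + r * ψ b r =
        (r * ψ b r - R * ψ b R) + R * (ψ b R - ψ a R) + (d + R * ψ a R) := by ring
      rw [e]
      refine (abs_add_three _ _ _).trans ?_
      have := abs_nonneg (b - a)
      linarith
    have h5 : d * (d + r * ψ b r) ≤ |d| * (|d| / 2) :=
      (le_abs_self _).trans (by rw [abs_mul]; gcongr)
    have h6 := sq_abs d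
    nlinarith
  have hanti : ∀ b, |b - a| < δ' →
      AntitoneOn (fun r => d * φ b r + d ^ 2 / 2 * log r) (Ici R) := by
    intro b hb
    have hderiv : ∀ r : ℝ, R ≤ r → HasDerivAt (fun r => d * φ b r + d ^ 2 / 2 * log r)
        (d * ψ b r + d ^ 2 / 2 * r⁻¹) r := fun r hr =>
      ((IsRadial.hasDerivAt (hφ b) r (hRp.trans_le hr)).const_mul d).add
        ((hasDerivAt_log (hRp.trans_le hr).ne').const_mul _)
    refine antitoneOn_of_hasDerivWithinAt_nonpos (convex_Ici R)
      (fun r hr => (hderiv r hr).continuousAt.continuousWithinAt)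
      (fun r hr => (hderiv r (interior_subset hr)).hasDerivWithinAt) fun r hr => ?_
    have hr : R ≤ r := interior_subset hr
    have hr0 : 0 < r := hRp.trans_le hr
    have h1 := hder b hb r hr
    have e : d * ψ b r + d ^ 2 / 2 * r⁻¹ = (d * (r * ψ b r) + d ^ 2 / 2) * r⁻¹ := by
      field_simp
    rw [e]
    exact mul_nonpos_of_nonpos_of_nonneg (by linarith) (by positivity)
  obtain ⟨C', hC', HC'⟩ := exists_linearized_le hN (a + 1) R
  obtain ⟨R₁, hR₁, hlarge⟩ : ∃ R₁, R ≤ R₁ ∧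
      |d| * C' + d ^ 2 / 2 * log R < d ^ 2 / 2 * log R₁ := by
    have h0 : Tendsto (fun R : ℝ => d ^ 2 / 2 * log R) atTop atTop :=
      tendsto_log_atTop.const_mul_atTop (by positivity)
    exact ((eventually_ge_atTop R).and (h0.eventually_gt_atTop _)).exists
  have hR₁0 : 0 < R₁ := hRp.trans_le hR₁
  refine ⟨R₁, hR₁0, δ', hδ'0, fun b hb r hr hzero => ?_⟩
  have hbM := (abs_lt.1 ((hb.trans_le (min_le_left _ _)).trans_le hδ1)).2
  have h1 := hanti b hb self_mem_Ici (hR₁.trans hr) (hR₁.trans hr)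
  simp only [hzero, mul_zero, zero_add] at h1
  have h2 : d * φ b R ≤ |d| * C' := by
    refine (le_abs_self _).trans ?_
    rw [abs_mul]
    gcongr
    exact (HC' (u b) (p b) (φ b) (ψ b) (hu b) (hφ b) (by rw [hu0]; linarith) (hφ0 b) R
      hRp.le le_rfl).1
  have h3 : log R₁ ≤ log r := log_le_log hR₁0 hr
  have h4 : d ^ 2 / 2 * log R₁ ≤ d ^ 2 / 2 * log r := by gcongr
  linarith

end Family

/-- Near every point of `[0, R]` where `|f| ≤ δ` the derivative `f'` is bounded below by `m`
on an interval of radius `ρ` contained in `[0, R]`. -/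
def IsTransversal (f f' : ℝ → ℝ) (R δ ρ m : ℝ) : Prop :=
  ∀ z ∈ Icc 0 R, |f z| ≤ δ → ρ ≤ z ∧ z ≤ R - ρ ∧ ∀ x ∈ Icc (z - ρ) (z + ρ), m ≤ |f' x|

section Transversal

variable {f f' g g' : ℝ → ℝ} {R δ ρ m : ℝ}

theorem exists_isTransversal (hR : 0 ≤ R) (hf : ContinuousOn f (Icc 0 R))
    (hf' : ContinuousOn f' (Icc 0 R)) (h0 : f 0 ≠ 0) (hfR : f R ≠ 0)
    (hsimple : ∀ z ∈ Icc 0 R, f z = 0 → f' z ≠ 0) :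
    ∃ δ > 0, ∃ ρ > 0, ∃ m > 0, IsTransversal f f' R δ ρ m := by
  obtain ⟨x₀, hx₀, hmin⟩ := isCompact_Icc.exists_isMinOn (nonempty_Icc.2 hR)
    (f := fun x => |f x| + |f' x|) (by fun_prop)
  set μ := |f x₀| + |f' x₀| with hμ
  have hμ0 : 0 < μ := by
    by_cases h : f x₀ = 0
    · have := abs_pos.2 (hsimple x₀ hx₀ h)
      have := abs_nonneg (f x₀)
      linarith
    · have := abs_pos.2 h
      have := abs_nonneg (f' x₀)
      linarith
  have hmin' : ∀ x ∈ Icc 0 R, μ ≤ |f x| + |f' x| := fun x hx => hmin hx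
  set κ := min μ (min |f 0| |f R|) with hκ
  have hκ0 : 0 < κ := lt_min hμ0 (lt_min (abs_pos.2 h0) (abs_pos.2 hfR))
  have hκμ : κ ≤ μ := min_le_left _ _
  have hκ0' : κ ≤ |f 0| := (min_le_right _ _).trans (min_le_left _ _)
  have hκR : κ ≤ |f R| := (min_le_right _ _).trans (min_le_right _ _)
  obtain ⟨ρ₁, hρ₁, H₁⟩ := Metric.uniformContinuousOn_iff.1
    (isCompact_Icc.uniformContinuousOn_of_continuous hf) (κ / 4) (by positivity)
  obtain ⟨ρ₂, hρ₂, H₂⟩ := Metric.uniformContinuousOn_iff.1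
    (isCompact_Icc.uniformContinuousOn_of_continuous hf') (μ / 4) (by positivity)
  simp only [Real.dist_eq] at H₁ H₂
  set ρ := min ρ₁ ρ₂ / 2 with hρ
  have hρ0 : 0 < ρ := by positivity
  have hm : 0 < min ρ₁ ρ₂ := by positivity
  have hρ1 : ρ < ρ₁ := by linarith [min_le_left ρ₁ ρ₂]
  have hρ2 : ρ < ρ₂ := by linarith [min_le_right ρ₁ ρ₂]
  refine ⟨κ / 4, by positivity, ρ, hρ0, μ / 2, by positivity, fun z hz hfz => ?_⟩
  have hleft : ρ ≤ z := by
    by_contra! hlt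
    have h1 := H₁ 0 (left_mem_Icc.2 hR) z hz (by
      rw [zero_sub, abs_neg, abs_of_nonneg hz.1]; linarith)
    have := abs_sub_abs_le_abs_sub (f 0) (f z)
    linarith
  have hright : z ≤ R - ρ := by
    by_contra! hlt
    have h1 := H₁ R (right_mem_Icc.2 hR) z hz (by
      rw [abs_of_nonneg (by linarith [hz.2])]; linarith)
    have := abs_sub_abs_le_abs_sub (f R) (f z)
    linarith
  refine ⟨hleft, hright, fun x hx => ?_⟩
  have h1 := H₂ z hz x ⟨by linarith [hx.1], by linarith [hx.2]⟩ (by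
    rw [abs_lt]; constructor <;> linarith [hx.1, hx.2])
  have := abs_sub_abs_le_abs_sub (f' z) (f' x)
  have := hmin' z hz
  linarith

theorem IsTransversal.perturb (h : IsTransversal f f' R δ ρ m)
    (hfg : ∀ x ∈ Icc 0 R, |f x - g x| ≤ δ / 2) (hfg' : ∀ x ∈ Icc 0 R, |f' x - g' x| ≤ m / 2) :
    IsTransversal g g' R (δ / 2) ρ (m / 2) := by
  intro z hz hgz
  have h1 := abs_sub_abs_le_abs_sub (f z) (g z)
  obtain ⟨h2, h3, h4⟩ := h z hz (by linarith [hfg z hz])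
  refine ⟨h2, h3, fun x hx => ?_⟩
  have := abs_sub_abs_le_abs_sub (f' x) (g' x)
  have := hfg' x ⟨by linarith [hx.1], by linarith [hx.2]⟩
  linarith [h4 x hx]

/-- The zeroes of `f` in `(0, R)`. -/
def zeroesIn (f : ℝ → ℝ) (R : ℝ) : Set ℝ := {r | r ∈ Ioo 0 R ∧ f r = 0}

theorem IsTransversal.eq_of_abs_sub_lt (h : IsTransversal f f' R δ ρ m) (hδ : 0 < δ)
    (hm : 0 < m) (hf : ContinuousOn f (Icc 0 R)) (hd : ∀ r ∈ Ioo 0 R, HasDerivAt f (f' r) r)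
    {x y : ℝ} (hx : x ∈ zeroesIn f R) (hy : y ∈ zeroesIn f R) (hxy : |x - y| < ρ) : x = y := by
  wlog hlt : x < y generalizing x y
  · rcases (not_lt.1 hlt).lt_or_eq with h' | h'
    · exact (this hy hx (by rwa [abs_sub_comm]) h').symm
    · exact h'.symm
  obtain ⟨c, hc, hc0⟩ := exists_hasDerivAt_eq_zero hlt
    (hf.mono (Icc_subset_Icc hx.1.1.le hy.1.2.le)) (hx.2.trans hy.2.symm)
    (fun r hr => hd r ⟨hx.1.1.trans hr.1, hr.2.trans hy.1.2⟩)
  have hcy := (h x (Ioo_subset_Icc_self hx.1) (by rw [hx.2]; simpa using hδ.le)).2.2 c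
    ⟨by linarith [hc.1, (abs_nonneg (x - y)).trans_lt hxy], by linarith [hc.2, (abs_lt.1 hxy).1]⟩
  rw [hc0, abs_zero] at hcy
  linarith

theorem IsTransversal.finite_zeroesIn (h : IsTransversal f f' R δ ρ m) (hδ : 0 < δ) (hρ : 0 < ρ)
    (hm : 0 < m) (hf : ContinuousOn f (Icc 0 R)) (hd : ∀ r ∈ Ioo 0 R, HasDerivAt f (f' r) r) :
    (zeroesIn f R).Finite := by
  refine Set.Finite.of_injOn (f := fun z => ⌊z / ρ⌋) (t := Icc 0 ⌊R / ρ⌋) (fun z hz => ?_)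
    (fun x hx y hy hxy => ?_) (finite_Icc _ _)
  · constructor
    · exact Int.floor_nonneg.2 (div_nonneg hz.1.1.le hρ.le)
    · exact Int.floor_le_floor (by have := hz.1.2.le; gcongr)
  · apply h.eq_of_abs_sub_lt hδ hm hf hd hx hy
    have := Int.abs_sub_lt_one_of_floor_eq_floor hxy
    rwa [← sub_div, abs_div, abs_of_pos hρ, div_lt_one hρ] at this

theorem IsTransversal.exists_zero_near (h : IsTransversal f f' R δ ρ m) (hδ : 0 < δ) (hρ : 0 < ρ)
    (hm : 0 < m) (hf : ContinuousOn f (Icc 0 R)) (hf' : ContinuousOn f' (Icc 0 R))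
    (hd : ∀ r ∈ Ioo 0 R, HasDerivAt f (f' r) r) (hg : ContinuousOn g (Icc 0 R))
    (hfg : ∀ x ∈ Icc 0 R, |f x - g x| < m * (ρ / 3)) {z : ℝ} (hz : z ∈ zeroesIn f R) :
    ∃ w ∈ zeroesIn g R, |z - w| ≤ ρ / 3 := by
  obtain ⟨hz1, hz2, hz3⟩ := h z (Ioo_subset_Icc_self hz.1) (by rw [hz.2]; simpa using hδ.le)
  set τ := ρ / 3 with hτ
  have hτ0 : 0 < τ := by positivity
  have hsub : Icc (z - τ) (z + τ) ⊆ Ioo 0 R := fun x hx =>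
    ⟨by linarith [hx.1], by linarith [hx.2]⟩
  have hsub' := hsub.trans Ioo_subset_Icc_self
  obtain ⟨c₁, hc₁, e₁⟩ := exists_hasDerivAt_eq_slope f f' (by linarith : z < z + τ)
    (hf.mono ((Icc_subset_Icc_left (by linarith)).trans hsub'))
    (fun x hx => hd x (hsub ⟨by linarith [hx.1], hx.2.le⟩))
  obtain ⟨c₂, hc₂, e₂⟩ := exists_hasDerivAt_eq_slope f f' (by linarith : z - τ < z)
    (hf.mono ((Icc_subset_Icc_right (by linarith)).trans hsub'))
    (fun x hx => hd x (hsub ⟨hx.1.le, by linarith [hx.2]⟩))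
  rw [hz.2, sub_zero, add_sub_cancel_left, eq_div_iff hτ0.ne'] at e₁
  rw [hz.2, zero_sub, sub_sub_cancel, eq_div_iff hτ0.ne'] at e₂
  have hlow : ∀ x ∈ Icc (z - τ) (z + τ), m ≤ |f' x| := fun x hx =>
    hz3 x ⟨by linarith [hx.1], by linarith [hx.2]⟩
  have hc₁' : c₁ ∈ Icc (z - τ) (z + τ) := ⟨by linarith [hc₁.1], hc₁.2.le⟩
  have hc₂' : c₂ ∈ Icc (z - τ) (z + τ) := ⟨hc₂.1.le, by linarith [hc₂.2]⟩
  have hivt : ∀ {k : ℝ → ℝ}, ContinuousOn k (Icc (z - τ) (z + τ)) →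
      ∀ x ∈ Icc (z - τ) (z + τ), ∀ y ∈ Icc (z - τ) (z + τ), k x ≤ 0 → 0 ≤ k y →
      ∃ c ∈ Icc (z - τ) (z + τ), k c = 0 := fun hk x hx y hy hkx hky =>
    isPreconnected_Icc.intermediate_value hx hy hk ⟨hkx, hky⟩
  have hno : ¬ ∃ c ∈ Icc (z - τ) (z + τ), f' c = 0 := by
    rintro ⟨c, hc, h0⟩
    have := hlow c hc
    rw [h0, abs_zero] at this
    linarith
  have hz₁ : z + τ ∈ Icc (z - τ) (z + τ) := ⟨by linarith, le_rfl⟩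
  have hz₂ : z - τ ∈ Icc (z - τ) (z + τ) := ⟨le_rfl, by linarith⟩
  have hg₁ := abs_lt.1 (hfg _ (hsub' hz₁))
  have hg₂ := abs_lt.1 (hfg _ (hsub' hz₂))
  obtain ⟨w, hw, hw0⟩ : ∃ w ∈ Icc (z - τ) (z + τ), g w = 0 := by
    rcases le_abs'.1 (hlow c₁ hc₁') with h₁ | h₁ <;> rcases le_abs'.1 (hlow c₂ hc₂') with h₂ | h₂
    · exact hivt (hg.mono hsub') _ hz₁ _ hz₂ (by nlinarith) (by nlinarith)
    · exact absurd (hivt (hf'.mono hsub') _ hc₁' _ hc₂' (by linarith) (by linarith)) hno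
    · exact absurd (hivt (hf'.mono hsub') _ hc₂' _ hc₁' (by linarith) (by linarith)) hno
    · exact hivt (hg.mono hsub') _ hz₂ _ hz₁ (by nlinarith) (by nlinarith)
  refine ⟨w, ⟨hsub hw, hw0⟩, ?_⟩
  rw [abs_le]
  constructor <;> linarith [hw.1, hw.2]

theorem IsTransversal.ncard_zeroesIn_le (h : IsTransversal f f' R δ ρ m) (hδ : 0 < δ) (hρ : 0 < ρ)
    (hm : 0 < m) (hf : ContinuousOn f (Icc 0 R)) (hf' : ContinuousOn f' (Icc 0 R))
    (hd : ∀ r ∈ Ioo 0 R, HasDerivAt f (f' r) r) (hg : ContinuousOn g (Icc 0 R))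
    (hfg : ∀ x ∈ Icc 0 R, |f x - g x| < m * (ρ / 3)) (hfin : (zeroesIn g R).Finite) :
    (zeroesIn f R).ncard ≤ (zeroesIn g R).ncard := by
  choose! k hk using fun z (hz : z ∈ zeroesIn f R) =>
    h.exists_zero_near hδ hρ hm hf hf' hd hg hfg hz
  refine ncard_le_ncard_of_injOn k (fun z hz => (hk z hz).1) (fun x hx y hy hxy => ?_) hfin
  apply h.eq_of_abs_sub_lt hδ hm hf hd hx hy
  have h1 := (hk x hx).2
  have h2 := (hk y hy).2
  rw [hxy] at h1
  have h3 := abs_sub_le x (k y) y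
  rw [abs_sub_comm (k y) y] at h3
  linarith

/-- A function with only simple zeroes on `[0, R]`, nonzero at the endpoints, has finitely many
zeroes, and their number is unchanged by `C¹`-small perturbations. -/
theorem exists_ncard_zeroesIn_eq (hR : 0 ≤ R) (hf : ContinuousOn f (Icc 0 R))
    (hf' : ContinuousOn f' (Icc 0 R)) (hd : ∀ r ∈ Ioo 0 R, HasDerivAt f (f' r) r)
    (h0 : f 0 ≠ 0) (hfR : f R ≠ 0) (hsimple : ∀ z ∈ Icc 0 R, f z = 0 → f' z ≠ 0) :
    (zeroesIn f R).Finite ∧ ∃ κ > 0, ∀ g g' : ℝ → ℝ, ContinuousOn g (Icc 0 R) →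
      ContinuousOn g' (Icc 0 R) → (∀ r ∈ Ioo 0 R, HasDerivAt g (g' r) r) →
      (∀ x ∈ Icc 0 R, |f x - g x| ≤ κ ∧ |f' x - g' x| ≤ κ) →
      (zeroesIn g R).ncard = (zeroesIn f R).ncard := by
  obtain ⟨δ, hδ, ρ, hρ, m, hm, h⟩ := exists_isTransversal hR hf hf' h0 hfR hsimple
  have hfin := h.finite_zeroesIn hδ hρ hm hf hd
  refine ⟨hfin, min (min (δ / 2) (m / 2)) (m * ρ / 12), by positivity,
    fun g g' hg hg' hdg hfg => ?_⟩
  have hg1 : ∀ x ∈ Icc 0 R, |f x - g x| ≤ δ / 2 := fun x hx =>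
    (hfg x hx).1.trans ((min_le_left _ _).trans (min_le_left _ _))
  have hg2 : ∀ x ∈ Icc 0 R, |f' x - g' x| ≤ m / 2 := fun x hx =>
    (hfg x hx).2.trans ((min_le_left _ _).trans (min_le_right _ _))
  have hg3 : ∀ x ∈ Icc 0 R, |f x - g x| < m / 2 * (ρ / 3) := fun x hx => by
    have := (hfg x hx).1.trans (min_le_right _ _)
    have := mul_pos hm hρ
    linarith
  have hG := h.perturb hg1 hg2
  have hδ' := half_pos hδ
  have hm' := half_pos hm
  have hfing := hG.finite_zeroesIn hδ' hρ hm' hg hdg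
  apply le_antisymm
  · exact hG.ncard_zeroesIn_le hδ' hρ hm' hg hg' hdg hf
      (fun x hx => by rw [abs_sub_comm]; exact hg3 x hx) hfin
  · exact h.ncard_zeroesIn_le hδ hρ hm hf hf' hd hg
      (fun x hx => (hg3 x hx).trans_le (by have := mul_pos hm hρ; linarith)) hfing

end Transversal

theorem eventually_ncard_zeroes_linearized_eq {N : ℝ} {u p φ ψ : ℝ → ℝ → ℝ} {α : ℝ → ℝ}
    (hN : 0 ≤ N) (hu : ∀ a, IsRadialLiouville N (u a) (p a))
    (hu0 : ∀ a, u a 0 = a) (hφ : ∀ a, IsRadialLinearized N (u a) (φ a) (ψ a))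
    (hφ0 : ∀ a, φ a 0 = 1) (hα : ∀ a, Tendsto (fun r => r * p a r) atTop (𝓝 (-α a)))
    {a d : ℝ} (hint : IntegrableOn (fun r => (1 + r ^ 2) ^ N * exp (2 * u a r) * r) (Ioi 0))
    (hd : HasDerivAt α d a) (hd0 : d ≠ 0) :
    {r : ℝ | 0 < r ∧ φ a r = 0}.Finite ∧
      ∀ᶠ b in 𝓝 a, {r : ℝ | 0 < r ∧ φ b r = 0}.ncard = {r : ℝ | 0 < r ∧ φ a r = 0}.ncard := by
  obtain ⟨R, hR, δ, hδ, hne⟩ :=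
    exists_forall_linearized_ne_zero hN hu hu0 hφ hφ0 hα hint hd hd0
  have hset : ∀ b, |b - a| < δ → {r : ℝ | 0 < r ∧ φ b r = 0} = zeroesIn (φ b) R := by
    intro b hb
    ext r
    refine ⟨fun h => ⟨⟨h.1, ?_⟩, h.2⟩, fun h => ⟨h.1.1, h.2⟩⟩
    by_contra! hr
    exact hne b hb r hr h.2
  have ha : |a - a| < δ := by simpa using hδ
  have hcont : ∀ b, ContinuousOn (φ b) (Icc 0 R) := fun b =>
    (IsRadial.cont (hφ b)).mono Icc_subset_Ici_self
  have hcont' : ∀ b, ContinuousOn (ψ b) (Icc 0 R) := fun b =>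
    (IsRadial.cont_deriv (hφ b)).mono Icc_subset_Ici_self
  have hderiv : ∀ b, ∀ r ∈ Ioo 0 R, HasDerivAt (φ b) (ψ b r) r := fun b r hr =>
    IsRadial.hasDerivAt (hφ b) r hr.1
  have hz : φ a 0 ≠ 0 := by rw [hφ0]; exact one_ne_zero
  obtain ⟨hfin, κ, hκ, hcount⟩ := exists_ncard_zeroesIn_eq hR.le (hcont a) (hcont' a) (hderiv a)
    hz (hne a ha R le_rfl) (fun z hz' h => (hφ a).deriv_ne_zero hN (hu a) hz
      (hz'.1.lt_of_ne fun h' => hz (h' ▸ h)) h)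
  rw [hset a ha]
  refine ⟨hfin, ?_⟩
  obtain ⟨C, hC, HC⟩ := exists_linearized_sub_le hN (a + 1) R
  filter_upwards [Metric.ball_mem_nhds a
    (show 0 < min (min δ 1) (κ / (C + 1)) by positivity)] with b hb
  rw [Metric.mem_ball, Real.dist_eq, lt_min_iff, lt_min_iff, lt_div_iff₀' (by positivity)] at hb
  obtain ⟨⟨hb1, hb2⟩, hb3⟩ := hb
  rw [hset b hb1]
  refine hcount (φ b) (ψ b) (hcont b) (hcont' b) (hderiv b) fun x hx => ?_
  have h := HC (u a) (p a) (u b) (p b) (φ a) (ψ a) (φ b) (ψ b) (hu a) (hu b) (hφ a) (hφ b)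
    (by rw [hu0]; linarith) (by rw [hu0]; linarith [(abs_lt.1 hb2).2]) (hφ0 a) (hφ0 b) x hx.1 hx.2
  rw [hu0, hu0, abs_sub_comm a b] at h
  have := abs_nonneg (b - a)
  exact ⟨by linarith [h.1], by linarith [h.2]⟩

end

/-- If `a₁ < a₂` are consecutive critical points of `α`, then for all `a, b` strictly
between `a₁` and `a₂`, the functions `φ_a` and `φ_b` have the same finite number of
zeroes in `(0,∞)`. -/
theorem same_number_of_zeroes_between_critical_points (N : ℝ) (hN : 1 ≤ N)
    (u : ℝ → ℝ → ℝ) (hu : ∀ a : ℝ, IsSol N (u a) ∧ u a 0 = a)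
    (φ : ℝ → ℝ → ℝ) (hφ : ∀ a : ℝ, IsLin N (u a) (φ a))
    (α : ℝ → ℝ)
    (hα : ∀ a : ℝ, α a = ∫ r in Ioi (0:ℝ), (1 + r ^ 2) ^ N * Real.exp (2 * u a r) * r)
    (a₁ a₂ : ℝ) (h12 : a₁ < a₂)
    (hc1 : deriv α a₁ = 0) (hc2 : deriv α a₂ = 0)
    (hnc : ∀ a ∈ Ioo a₁ a₂, deriv α a ≠ 0) :
    ∀ a ∈ Ioo a₁ a₂, ∀ b ∈ Ioo a₁ a₂,
      {r : ℝ | 0 < r ∧ φ a r = 0}.Finite ∧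
      {r : ℝ | 0 < r ∧ φ a r = 0}.ncard = {r : ℝ | 0 < r ∧ φ b r = 0}.ncard := by
  have hN0 : 0 ≤ N := by linarith
  have hU : ∀ a, IsRadialLiouville N (u a) (derivWithin (u a) (Ici 0)) := fun a =>
    isRadial_of_contDiffOn (hu a).1.1 (hu a).1.2.2.1 fun r hr => by
      linarith [(hu a).1.2.1 r hr]
  have hΦ : ∀ a, IsRadialLinearized N (u a) (φ a) (derivWithin (φ a) (Ici 0)) := fun a =>
    isRadial_of_contDiffOn (hφ a).1 (hφ a).2.2.2 fun r hr => by
      linarith [(hφ a).2.1 r hr]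
  have hint := fun a => (hu a).1.2.2.2
  have hlim : ∀ a, Filter.Tendsto (fun r => r * derivWithin (u a) (Ici 0) r) atTop
      (nhds (-α a)) := fun a => by
    rw [hα]
    exact (hU a).tendsto_mul_deriv hN0 (hint a)
  have hloc := fun a (ha : a ∈ Ioo a₁ a₂) =>
    eventually_ncard_zeroes_linearized_eq hN0 hU (fun a => (hu a).2) hΦ
      (fun a => (hφ a).2.2.1) hlim (hint a)
      (differentiableAt_of_deriv_ne_zero (hnc a ha)).hasDerivAt (hnc a ha)
  intro a ha b hb
  refine ⟨(hloc a ha).1, isPreconnected_Ioo.constant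
    (f := fun a => {r : ℝ | 0 < r ∧ φ a r = 0}.ncard) (fun c hc => ?_) ha hb⟩
  exact (tendsto_const_nhds.congr' ((hloc c hc).2.mono fun _ h => h.symm)).mono_left
    nhdsWithin_le_nhds
end
end
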